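/- arXiv:1608.04679 — 11 statements merged into one kernel-verified Lean document; each statement's English description precedes it below -/
import Mathlib

section
/- Let D̄(θ) and R̄(θ) be the parametric waterfilling distortion and rate for the discrete-time Wiener process. Then the product D̄(θ)·R̄(θ) tends to 2/(π²·ln 2) as θ → ∞. (Equivalently, with the bitrate R fixed and the sampling rate f_s → ∞, the distortion-rate function (σ²/f_s)·D̄ of the sampled Wiener process at R/f_s bits per sample converges to the distortion-rate function of the continuous-time Wiener process, D_W(R) = 2σ²/(π²·ln 2)·R⁻¹.) -/
open Real Filter MeasureTheory

/-- The asymptotic eigenvalue density `S(φ) = 1/(4 sin²(πφ/2))` of the covariance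
matrices of the sampled Wiener process. -/
noncomputable def S (φ : ℝ) : ℝ := 1 / (4 * Real.sin (Real.pi * φ / 2) ^ 2)

/-- Parametric waterfilling distortion of the discrete-time Wiener process. -/
noncomputable def Dbar (θ : ℝ) : ℝ := ∫ φ in (0:ℝ)..1, min (S φ) θ

/-- Parametric waterfilling rate (bits per sample) of the discrete-time Wiener process. -/
noncomputable def Rbar (θ : ℝ) : ℝ :=
  (1 / 2) * ∫ φ in (0:ℝ)..1, max 0 (Real.logb 2 (S φ / θ))

lemma aux_facts {a : ℝ} (ha : 0 < a) (ha2 : a < π / 2) :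
    0 < 2 * a / π ∧ 2 * a / π < 1 := by
  have hp := Real.pi_pos
  constructor
  · positivity
  · rw [div_lt_one hp]; linarith

lemma aux_b {a φ : ℝ} (h : φ ≤ 2 * a / π) : π * φ / 2 ≤ a := by
  have hp := Real.pi_pos
  rw [le_div_iff₀ hp] at h; linarith

lemma aux_b' {a φ : ℝ} (h : 2 * a / π ≤ φ) : a ≤ π * φ / 2 := by
  have hp := Real.pi_pos
  rw [div_le_iff₀ hp] at h; linarith

/-- left of the threshold -/
lemma S_ge {a φ : ℝ} (ha2 : a < π / 2) (h0 : 0 < φ) (h : φ ≤ 2 * a / π) :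
    1 / (4 * sin a ^ 2) ≤ S φ := by
  have hp := Real.pi_pos
  have hb := aux_b h
  have hb0 : 0 < π * φ / 2 := by positivity
  have hs : 0 < sin (π * φ / 2) := sin_pos_of_pos_of_lt_pi hb0 (by linarith)
  have hle : sin (π * φ / 2) ≤ sin a :=
    sin_le_sin_of_le_of_le_pi_div_two (by linarith) (by linarith) hb
  unfold S
  gcongr

lemma S_le {a φ : ℝ} (ha : 0 < a) (h1 : φ ≤ 1) (h : 2 * a / π ≤ φ) :
    S φ ≤ 1 / (4 * sin a ^ 2) := by
  have hp := Real.pi_pos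
  have hb := aux_b' h
  have h2 : π * φ / 2 ≤ π / 2 := by nlinarith
  have hs : 0 < sin a := sin_pos_of_pos_of_lt_pi ha (by linarith)
  have hle : sin a ≤ sin (π * φ / 2) :=
    sin_le_sin_of_le_of_le_pi_div_two (by linarith) h2 hb
  unfold S
  gcongr

lemma S_int {a : ℝ} (ha : 0 < a) (ha2 : a < π / 2) :
    IntervalIntegrable S volume (2 * a / π) 1 ∧
    ∫ φ in (2 * a / π)..1, S φ = cos a / (2 * π * sin a) := by
  have hp := Real.pi_pos
  obtain ⟨hc0, hc1⟩ := aux_facts ha ha2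
  have hs : ∀ φ ∈ Set.uIcc (2 * a / π) 1, sin (π * φ / 2) ≠ 0 := by
    intro φ hφ
    rw [Set.uIcc_of_le hc1.le] at hφ
    have := aux_b' hφ.1
    have h2 : π * φ / 2 ≤ π / 2 := by nlinarith [hφ.2]
    exact (sin_pos_of_pos_of_lt_pi (by linarith) (by linarith)).ne'
  have hint : IntervalIntegrable S volume (2 * a / π) 1 := by
    apply ContinuousOn.intervalIntegrable
    unfold S
    apply ContinuousOn.div continuousOn_const (by fun_prop)
    intro φ hφ
    have := hs φ hφ
    positivity
  refine ⟨hint, ?_⟩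
  have hd : ∀ φ ∈ Set.uIcc (2 * a / π) 1,
      HasDerivAt (fun φ => -(cos (π * φ / 2) / sin (π * φ / 2)) / (2 * π)) (S φ) φ := by
    intro φ hφ
    have h := hs φ hφ
    have hl : HasDerivAt (fun φ : ℝ => π * φ / 2) (π / 2) φ := by
      simpa using ((hasDerivAt_id φ).const_mul π).div_const 2
    have := ((hl.cos.div hl.sin h).neg).div_const (2 * π)
    refine this.congr_deriv ?_
    unfold S
    have e := sin_sq_add_cos_sq (π * φ / 2)
    field_simp
    linear_combination 4 * e
  rw [intervalIntegral.integral_eq_sub_of_hasDerivAt hd hint]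
  have e : π * (2 * a / π) / 2 = a := by field_simp
  have hsa : sin a ≠ 0 := (sin_pos_of_pos_of_lt_pi ha (by linarith)).ne'
  rw [e]
  simp
  field_simp

lemma D_eq {a : ℝ} (ha : 0 < a) (ha2 : a < π / 2) :
    Dbar (1 / (4 * sin a ^ 2)) =
      2 * a / π * (1 / (4 * sin a ^ 2)) + cos a / (2 * π * sin a) := by
  obtain ⟨hc0, hc1⟩ := aux_facts ha ha2
  obtain ⟨hi, he⟩ := S_int ha ha2
  have h1 : Set.EqOn (fun _ => 1 / (4 * sin a ^ 2)) (fun φ => min (S φ) (1 / (4 * sin a ^ 2)))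
      (Set.uIoo 0 (2 * a / π)) := by
    intro φ hφ
    rw [Set.uIoo_of_le hc0.le] at hφ
    exact (min_eq_right (S_ge ha2 hφ.1 hφ.2.le)).symm
  have h2 : Set.EqOn S (fun φ => min (S φ) (1 / (4 * sin a ^ 2)))
      (Set.uIoo (2 * a / π) 1) := by
    intro φ hφ
    rw [Set.uIoo_of_le hc1.le] at hφ
    exact (min_eq_left (S_le ha hφ.2.le hφ.1.le)).symm
  unfold Dbar
  rw [← intervalIntegral.integral_add_adjacent_intervals (b := 2 * a / π)
    ((intervalIntegrable_const (c := 1 / (4 * sin a ^ 2))).congr_uIoo h1) (hi.congr_uIoo h2),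
    ← intervalIntegral.integral_congr_uIoo h1, ← intervalIntegral.integral_congr_uIoo h2, he]
  simp
  ring

lemma log_sin_int (x y : ℝ) :
    IntervalIntegrable (fun φ => log (sin (π * φ / 2))) volume x y := by
  have : MeromorphicOn (fun φ : ℝ => sin (π * φ / 2)) (Set.uIcc x y) := by
    intro z _
    apply AnalyticAt.meromorphicAt
    have : AnalyticAt ℝ (fun φ : ℝ => π * φ / 2) z := by fun_prop
    exact (analyticAt_sin).comp this
  exact this.intervalIntegrable_log

lemma R_eq {a : ℝ} (ha : 0 < a) (ha2 : a < π / 2) :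
    Rbar (1 / (4 * sin a ^ 2)) =
      (1 / log 2) * ∫ φ in (0:ℝ)..(2 * a / π), (log (sin a) - log (sin (π * φ / 2))) := by
  have hp := Real.pi_pos
  obtain ⟨hc0, hc1⟩ := aux_facts ha ha2
  have hsa : 0 < sin a := (sin_pos_of_pos_of_lt_pi ha (by linarith))
  have hl2 : 0 < log 2 := log_pos (by norm_num)
  have h1 : Set.EqOn (fun φ => 2 / log 2 * (log (sin a) - log (sin (π * φ / 2))))
      (fun φ => max 0 (logb 2 (S φ / (1 / (4 * sin a ^ 2)))))
      (Set.uIoo 0 (2 * a / π)) := by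
    intro φ hφ
    rw [Set.uIoo_of_le hc0.le] at hφ
    have hge := S_ge ha2 hφ.1 hφ.2.le
    have hb := aux_b hφ.2.le
    have hb0 : 0 < π * φ / 2 := by have := hφ.1; positivity
    have hs : 0 < sin (π * φ / 2) := sin_pos_of_pos_of_lt_pi hb0 (by linarith)
    have : 0 ≤ logb 2 (S φ / (1 / (4 * sin a ^ 2))) := by
      apply logb_nonneg (by norm_num)
      rw [le_div_iff₀ (by positivity), one_mul]
      exact hge
    simp only
    rw [max_eq_right this]
    have e : S φ / (1 / (4 * sin a ^ 2)) = (sin a / sin (π * φ / 2)) ^ 2 := by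
      unfold S; field_simp
    rw [e, logb, log_pow, log_div hsa.ne' hs.ne']
    push_cast
    ring
  have h2 : Set.EqOn (fun _ => (0:ℝ)) (fun φ => max 0 (logb 2 (S φ / (1 / (4 * sin a ^ 2)))))
      (Set.uIoo (2 * a / π) 1) := by
    intro φ hφ
    rw [Set.uIoo_of_le hc1.le] at hφ
    have hle := S_le ha hφ.2.le hφ.1.le
    refine (max_eq_left ?_).symm
    apply logb_nonpos (by norm_num)
    · apply div_nonneg <;> (try unfold S) <;> positivity
    · rw [div_le_one (by positivity)]; exact hle
  have hi : IntervalIntegrable (fun φ => 2 / log 2 * (log (sin a) - log (sin (π * φ / 2))))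
      volume 0 (2 * a / π) := (intervalIntegrable_const.sub (log_sin_int _ _)).const_mul _
  unfold Rbar
  rw [← intervalIntegral.integral_add_adjacent_intervals (b := 2 * a / π)
    (hi.congr_uIoo h1) ((intervalIntegrable_const (c := (0:ℝ))).congr_uIoo h2),
    ← intervalIntegral.integral_congr_uIoo h1, ← intervalIntegral.integral_congr_uIoo h2,
    intervalIntegral.integral_const_mul]
  simp
  ring

lemma sin_conc {a b : ℝ} (ha : 0 < a) (ha2 : a < π / 2) (hb : 0 < b) (hba : b ≤ a) :
    b / a * sin a ≤ sin b := by
  have hp := Real.pi_pos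
  have h0 : (0:ℝ) ∈ Set.Icc 0 π := ⟨le_rfl, pi_pos.le⟩
  have h1 : a ∈ Set.Icc 0 π := ⟨ha.le, by linarith⟩
  have h2 : 0 ≤ 1 - b / a := by rw [sub_nonneg, div_le_one ha]; exact hba
  have h3 : 0 ≤ b / a := by positivity
  have h := strictConcaveOn_sin_Icc.concaveOn.2 h0 h1 h2 h3 (by ring)
  have e : b / a * a = b := by field_simp
  simpa [e] using h

lemma R_bounds {a : ℝ} (ha : 0 < a) (ha2 : a < π / 2) :
    (1 / log 2) * (2 * a / π * (1 + log (sin a / a))) ≤ Rbar (1 / (4 * sin a ^ 2)) ∧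
    Rbar (1 / (4 * sin a ^ 2)) ≤ (1 / log 2) * (2 * a / π) := by
  have hp := Real.pi_pos
  obtain ⟨hc0, hc1⟩ := aux_facts ha ha2
  have hsa : 0 < sin a := (sin_pos_of_pos_of_lt_pi ha (by linarith))
  have hl2 : 0 < log 2 := log_pos (by norm_num)
  have hi : IntervalIntegrable (fun φ => (log (sin a) - log (sin (π * φ / 2))))
      volume 0 (2 * a / π) := (intervalIntegrable_const.sub (log_sin_int _ _))
  have hk : ∀ k : ℝ, IntervalIntegrable (fun φ => k - log φ) volume 0 (2 * a / π) := fun k =>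
    intervalIntegrable_const.sub intervalIntegral.intervalIntegrable_log'
  have hkI : ∀ k : ℝ, ∫ φ in (0:ℝ)..(2 * a / π), (k - log φ) =
      2 * a / π * (k - log (2 * a / π) + 1) := by
    intro k
    rw [intervalIntegral.integral_sub intervalIntegrable_const
      intervalIntegral.intervalIntegrable_log', integral_log]
    simp
    ring
  rw [R_eq ha ha2]
  constructor
  · gcongr
    have e : 2 * a / π * (1 + log (sin a / a)) =
        2 * a / π * ((log (sin a / a) + log (2 * a / π)) - log (2 * a / π) + 1) := by ring
    rw [e, ← hkI]
    apply intervalIntegral.integral_mono_on_of_le_Ioo hc0.le (hk _) hi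
    intro φ hφ
    have hφ0 := hφ.1
    have hb := aux_b hφ.2.le
    have hb0 : 0 < π * φ / 2 := by positivity
    have hs : 0 < sin (π * φ / 2) := sin_pos_of_pos_of_lt_pi hb0 (by linarith)
    have h1 : log (sin (π * φ / 2)) ≤ log (π * φ / 2) := log_le_log hs (sin_le hb0.le)
    rw [log_div hsa.ne' ha.ne', log_div (by positivity) hp.ne', log_mul two_ne_zero ha.ne']
    rw [log_div (by positivity) two_ne_zero, log_mul hp.ne' hφ0.ne'] at h1
    linarith
  · gcongr
    have e : 2 * a / π =
        2 * a / π * (log (2 * a / π) - log (2 * a / π) + 1) := by ring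
    refine le_trans ?_ e.ge
    rw [← hkI]
    apply intervalIntegral.integral_mono_on_of_le_Ioo hc0.le hi (hk _)
    intro φ hφ
    have hφ0 := hφ.1
    have hb := aux_b hφ.2.le
    have hb0 : 0 < π * φ / 2 := by positivity
    have h1 := log_le_log (by positivity) (sin_conc ha ha2 hb0 hb)
    rw [log_mul (by positivity) hsa.ne', log_div hb0.ne' ha.ne',
      log_div (by positivity) two_ne_zero, log_mul hp.ne' hφ0.ne'] at h1
    rw [log_div (by positivity) hp.ne', log_mul two_ne_zero ha.ne']
    linarith

lemma tendsto_sin_div : Tendsto (fun a : ℝ => sin a / a) (nhdsWithin 0 (Set.Ioi 0)) (nhds 1) := by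
  have h := (hasDerivAt_sin 0).tendsto_slope
  rw [cos_zero] at h
  refine (h.mono_left (nhdsWithin_mono _ (by intro x hx; exact ne_of_gt hx))).congr ?_
  intro x
  simp [slope_def_field]

lemma main_lim : Tendsto (fun a : ℝ => Dbar (1 / (4 * sin a ^ 2)) * Rbar (1 / (4 * sin a ^ 2)))
    (nhdsWithin 0 (Set.Ioi 0)) (nhds (2 / (π ^ 2 * log 2))) := by
  have hp := Real.pi_pos
  have hl2 : 0 < log 2 := log_pos (by norm_num)
  have hev : ∀ᶠ a : ℝ in nhdsWithin 0 (Set.Ioi 0), 0 < a ∧ a < π / 2 :=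
    Ioo_mem_nhdsGT (by positivity)
  have hq := tendsto_sin_div
  have hq' : Tendsto (fun a : ℝ => (sin a / a)⁻¹) (nhdsWithin 0 (Set.Ioi 0)) (nhds 1) := by
    simpa using hq.inv₀ one_ne_zero
  have hlog : Tendsto (fun a : ℝ => log (sin a / a)) (nhdsWithin 0 (Set.Ioi 0)) (nhds 0) := by
    simpa using hq.log one_ne_zero
  have hcos : Tendsto cos (nhdsWithin 0 (Set.Ioi 0)) (nhds 1) := by
    simpa using (continuous_cos.tendsto 0).mono_left nhdsWithin_le_nhds
  have hD : Tendsto (fun a : ℝ => Dbar (1 / (4 * sin a ^ 2)) * sin a)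
      (nhdsWithin 0 (Set.Ioi 0)) (nhds (1 / π)) := by
    have : Tendsto (fun a : ℝ => 1 / (2 * π) * (sin a / a)⁻¹ + 1 / (2 * π) * cos a)
      (nhdsWithin 0 (Set.Ioi 0)) (nhds (1 / (2 * π) * 1 + 1 / (2 * π) * 1)) :=
      (hq'.const_mul _).add (hcos.const_mul _)
    have e : 1 / (2 * π) * 1 + 1 / (2 * π) * 1 = 1 / π := by field_simp; norm_num
    rw [e] at this
    refine this.congr' ?_
    filter_upwards [hev] with a ⟨h0, h1⟩
    have hsa : 0 < sin a := (sin_pos_of_pos_of_lt_pi h0 (by linarith))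
    rw [D_eq h0 h1]
    field_simp
    try ring
  have hR : Tendsto (fun a : ℝ => Rbar (1 / (4 * sin a ^ 2)) / sin a)
      (nhdsWithin 0 (Set.Ioi 0)) (nhds (2 / (π * log 2))) := by
    have t1 : Tendsto (fun a : ℝ => 2 / (π * log 2) * ((sin a / a)⁻¹ * (1 + log (sin a / a))))
      (nhdsWithin 0 (Set.Ioi 0)) (nhds (2 / (π * log 2))) := by
      simpa using (hq'.mul (hlog.const_add 1)).const_mul (2 / (π * log 2))
    have t2 : Tendsto (fun a : ℝ => 2 / (π * log 2) * (sin a / a)⁻¹)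
      (nhdsWithin 0 (Set.Ioi 0)) (nhds (2 / (π * log 2))) := by
      simpa using hq'.const_mul (2 / (π * log 2))
    refine tendsto_of_tendsto_of_tendsto_of_le_of_le' t1 t2 ?_ ?_
    · filter_upwards [hev] with a ⟨h0, h1⟩
      have hsa : 0 < sin a := (sin_pos_of_pos_of_lt_pi h0 (by linarith))
      rw [le_div_iff₀ hsa]
      refine le_trans (le_of_eq ?_) (R_bounds h0 h1).1
      generalize log (sin a / a) = L
      field_simp
    · filter_upwards [hev] with a ⟨h0, h1⟩
      have hsa : 0 < sin a := (sin_pos_of_pos_of_lt_pi h0 (by linarith))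
      rw [div_le_iff₀ hsa]
      refine le_trans (R_bounds h0 h1).2 (le_of_eq ?_)
      field_simp
  have h := hD.mul hR
  have e : 1 / π * (2 / (π * log 2)) = 2 / (π ^ 2 * log 2) := by field_simp
  rw [e] at h
  refine h.congr' ?_
  filter_upwards [hev] with a ⟨h0, h1⟩
  have hsa : 0 < sin a := (sin_pos_of_pos_of_lt_pi h0 (by linarith))
  field_simp

/-- The product `D̄(θ)·R̄(θ)` tends to `2/(π² ln 2)` as `θ → ∞`. -/
theorem stmt0 :
    Tendsto (fun θ : ℝ => Dbar θ * Rbar θ) atTop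
      (nhds (2 / (Real.pi ^ 2 * Real.log 2))) := by
  have ht0 : Tendsto (fun θ : ℝ => (2 * √θ)⁻¹) atTop (nhds 0) :=
    tendsto_inv_atTop_zero.comp (tendsto_sqrt_atTop.const_mul_atTop two_pos)
  have ht : Tendsto (fun θ : ℝ => arcsin ((2 * √θ)⁻¹)) atTop (nhdsWithin 0 (Set.Ioi 0)) := by
    rw [tendsto_nhdsWithin_iff]
    constructor
    · have h := (continuous_arcsin.tendsto 0).comp ht0
      rw [arcsin_zero] at h
      exact h
    · filter_upwards [eventually_gt_atTop 0] with θ hθ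
      have : 0 < √θ := sqrt_pos.2 hθ
      exact arcsin_pos.2 (by positivity)
  refine (main_lim.comp ht).congr' ?_
  filter_upwards [eventually_gt_atTop 0, ht0.eventually (eventually_lt_nhds one_pos)] with θ hθ h1
  have h0 : 0 < √θ := sqrt_pos.2 hθ
  have hinv : 0 < (2 * √θ)⁻¹ := by positivity
  have hs : sin (arcsin ((2 * √θ)⁻¹)) = (2 * √θ)⁻¹ := sin_arcsin (by linarith) h1.le
  have e : 1 / (4 * sin (arcsin ((2 * √θ)⁻¹)) ^ 2) = θ := by
    rw [hs, inv_pow, mul_pow, sq_sqrt hθ.le]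
    field_simp
    norm_num
  simp only [Function.comp]
  rw [e]
end

section
/- The function θ ↦ D̄(θ)·R̄(θ) is nondecreasing on (0,∞), and its supremum over θ > 0 equals 2/(π²·ln 2). (Equivalently, for fixed bitrate R the distortion-rate function of the sampled Wiener process, D_{W̄}(R/f_s) = (σ²/f_s)·D̄, is monotonically increasing in the sampling rate f_s, with supremum equal to the distortion-rate function of the continuous-time Wiener process D_W(R) = 2σ²/(π²·ln 2)·R⁻¹.) -/
open Real Filter MeasureTheory

noncomputable def auxG (x : ℝ) : ℝ := x * log (sin x) - ∫ u in (0:ℝ)..x, log (sin u)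

lemma auxcongr {f g : ℝ → ℝ} {a b : ℝ} (h : Set.EqOn f g (Set.uIoc a b)) :
    ∫ u in a..b, f u = ∫ u in a..b, g u :=
  intervalIntegral.integral_congr_ae (Eventually.of_forall (fun _ hx => h hx))

lemma auxII (a b : ℝ) : IntervalIntegrable (fun u => log (sin u)) volume a b :=
  intervalIntegrable_log_sin

lemma auxG_cont : ContinuousOn auxG (Set.Icc 0 (π/2)) := by
  have h1 : ContinuousOn (fun x => (sin x * log (sin x)) / sinc x) (Set.Icc 0 (π/2)) := by
    apply ContinuousOn.div
    · exact (Real.continuous_mul_log.comp continuous_sin).continuousOn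
    · exact continuous_sinc.continuousOn
    · intro x hx
      by_cases h : x = 0
      · simp [h]
      · rw [sinc_of_ne_zero h]
        have hx0 : 0 < x := lt_of_le_of_ne hx.1 (Ne.symm h)
        have := sin_pos_of_pos_of_lt_pi hx0 (by linarith [hx.2, pi_pos])
        positivity
  have h2 : Continuous (fun x => ∫ u in (0:ℝ)..x, log (sin u)) :=
    intervalIntegral.continuous_primitive (fun a b => auxII a b) 0
  refine (h1.sub h2.continuousOn).congr ?_
  intro x hx
  simp only [auxG, Pi.sub_apply]
  by_cases h : x = 0
  · simp [h]
  · rw [sinc_of_ne_zero h]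
    have hx0 : 0 < x := lt_of_le_of_ne hx.1 (Ne.symm h)
    have := sin_pos_of_pos_of_lt_pi hx0 (by linarith [hx.2, pi_pos])
    field_simp

lemma auxG_deriv {x : ℝ} (h0 : 0 < x) (h1 : x < π) :
    HasDerivAt auxG (x * cos x / sin x) x := by
  have hs := sin_pos_of_pos_of_lt_pi h0 h1
  have hl : HasDerivAt (fun x => log (sin x)) (cos x / sin x) x := (hasDerivAt_sin x).log hs.ne'
  have h2 : HasDerivAt (fun x => ∫ u in (0:ℝ)..x, log (sin u)) (log (sin x)) x := by
    apply intervalIntegral.integral_hasDerivAt_right (auxII 0 x) _ hl.continuousAt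
    exact (Measurable.stronglyMeasurable (by fun_prop)).stronglyMeasurableAtFilter
  have := ((hasDerivAt_id x).mul hl).sub h2
  refine this.congr_deriv ?_
  simp only [id]; ring

lemma auxG_zero : auxG 0 = 0 := by simp [auxG]

lemma auxH {x : ℝ} (h0 : 0 ≤ x) (h1 : x ≤ π/2) : x + sin x * cos x ≤ 2 * auxG x := by
  have hm : MonotoneOn (fun x => 2 * auxG x - (x + sin x * cos x)) (Set.Icc 0 (π/2)) := by
    apply monotoneOn_of_hasDerivWithinAt_nonneg (convex_Icc _ _)
      (f' := fun x => 2 * (x * cos x / sin x) - (1 + (cos x * cos x + sin x * (-sin x))))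
    · exact (auxG_cont.const_smul (2:ℝ)).sub (by fun_prop)
    · intro x hx
      rw [interior_Icc] at hx
      exact (((auxG_deriv hx.1 (by linarith [hx.2, pi_pos])).const_mul 2).sub
        ((hasDerivAt_id x).add ((hasDerivAt_sin x).mul (hasDerivAt_cos x)))).hasDerivWithinAt
    · intro x hx
      rw [interior_Icc] at hx
      have hs := sin_pos_of_pos_of_lt_pi hx.1 (by linarith [hx.2, pi_pos])
      have hc := cos_pos_of_mem_Ioo ⟨by linarith [hx.1, pi_pos], hx.2⟩
      have e : 2 * (x * cos x / sin x) - (1 + (cos x * cos x + sin x * (-sin x)))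
          = 2 * cos x * (x - sin x * cos x) / sin x := by
        field_simp
        nlinarith [sin_sq_add_cos_sq x]
      simp only [e]
      have h3 := sin_lt hx.1
      have h4 := cos_le_one x
      have : 0 ≤ x - sin x * cos x := by nlinarith
      positivity
  have := hm ⟨le_rfl, by positivity⟩ ⟨h0, h1⟩ h0
  simp [auxG_zero] at this
  linarith

lemma auxG_le {x : ℝ} (h0 : 0 ≤ x) (h1 : x ≤ π/2) : auxG x ≤ x := by
  have hm : MonotoneOn (fun x => x - auxG x) (Set.Icc 0 (π/2)) := by
    apply monotoneOn_of_hasDerivWithinAt_nonneg (convex_Icc _ _)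
      (f' := fun x => 1 - (x * cos x / sin x))
    · exact continuousOn_id.sub auxG_cont
    · intro x hx
      rw [interior_Icc] at hx
      exact ((hasDerivAt_id x).sub (auxG_deriv hx.1 (by linarith [hx.2, pi_pos]))).hasDerivWithinAt
    · intro x hx
      rw [interior_Icc] at hx
      have hs := sin_pos_of_pos_of_lt_pi hx.1 (by linarith [hx.2, pi_pos])
      have hc := cos_pos_of_mem_Ioo ⟨by linarith [hx.1, pi_pos], hx.2⟩
      have := lt_tan hx.1 hx.2
      rw [tan_eq_sin_div_cos, lt_div_iff₀ hc] at this
      rw [sub_nonneg, div_le_one hs]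
      exact this.le
  have := hm ⟨le_rfl, by positivity⟩ ⟨h0, h1⟩ h0
  simp [auxG_zero] at this
  linarith

noncomputable def auxF (x : ℝ) : ℝ := (x + sin x * cos x) / sin x ^ 2 * auxG x

lemma auxF_anti : AntitoneOn auxF (Set.Ioc 0 (π/2)) := by
  apply antitoneOn_of_hasDerivWithinAt_nonpos (convex_Ioc _ _)
      (f' := fun x => x * cos x / sin x ^ 3 * (x + sin x * cos x - 2 * auxG x))
  · apply ContinuousOn.mul
    · apply ContinuousOn.div (by fun_prop) (by fun_prop)
      intro x hx
      have hs := sin_pos_of_pos_of_lt_pi hx.1 (by linarith [hx.2, pi_pos])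
      positivity
    · exact auxG_cont.mono Set.Ioc_subset_Icc_self
  · intro x hx
    rw [interior_Ioc] at hx
    have hs := sin_pos_of_pos_of_lt_pi hx.1 (by linarith [hx.2, pi_pos])
    have := ((((hasDerivAt_id x).add ((hasDerivAt_sin x).mul (hasDerivAt_cos x))).div
      ((hasDerivAt_sin x).pow 2) (pow_ne_zero 2 hs.ne')).mul
        (auxG_deriv hx.1 (by linarith [hx.2, pi_pos])))
    refine (this.congr_deriv ?_).hasDerivWithinAt
    simp
    field_simp
    have : sin x ^ 2 = 1 - cos x ^ 2 := by rw [← sin_sq_add_cos_sq x]; ring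
    rw [this]
    ring
  · intro x hx
    rw [interior_Ioc] at hx
    have hs := sin_pos_of_pos_of_lt_pi hx.1 (by linarith [hx.2, pi_pos])
    have hc := cos_pos_of_mem_Ioo ⟨by linarith [hx.1, pi_pos], hx.2⟩
    have := auxH hx.1.le hx.2.le
    have h0 := hx.1
    apply mul_nonpos_of_nonneg_of_nonpos
    · positivity
    · linarith

lemma auxF_tendsto : Tendsto auxF (nhdsWithin 0 (Set.Ioi 0)) (nhds 2) := by
  have hsinc : Tendsto sinc (nhdsWithin 0 (Set.Ioi 0)) (nhds 1) := by
    have := continuous_sinc.tendsto 0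
    rw [sinc_zero] at this
    exact this.mono_left nhdsWithin_le_nhds
  have hcos : Tendsto cos (nhdsWithin 0 (Set.Ioi 0)) (nhds 1) := by
    have := continuous_cos.tendsto 0
    rw [cos_zero] at this
    exact this.mono_left nhdsWithin_le_nhds
  have hev : ∀ᶠ x in nhdsWithin (0:ℝ) (Set.Ioi 0), x ∈ Set.Ioo 0 (π/2) :=
    Ioo_mem_nhdsGT (by positivity)
  have hlo : Tendsto (fun x => (1 / sinc x + cos x) ^ 2 / 2) (nhdsWithin 0 (Set.Ioi 0)) (nhds 2) := by
    have := ((((tendsto_const_nhds (x := (1:ℝ))).div hsinc one_ne_zero).add hcos).pow 2).div_const 2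
    norm_num at this ⊢
    exact this
  have hhi : Tendsto (fun x => (1 / sinc x + cos x) * (1 / sinc x))
      (nhdsWithin 0 (Set.Ioi 0)) (nhds 2) := by
    have := (((tendsto_const_nhds (x := (1:ℝ))).div hsinc one_ne_zero).add hcos).mul ((tendsto_const_nhds (x := (1:ℝ))).div hsinc one_ne_zero)
    norm_num at this ⊢
    exact this
  refine tendsto_of_tendsto_of_tendsto_of_le_of_le' hlo hhi ?_ ?_
  · filter_upwards [hev] with x hx
    have hs := sin_pos_of_pos_of_lt_pi hx.1 (by linarith [hx.2, pi_pos])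
    have hc := cos_pos_of_mem_Ioo ⟨by linarith [hx.1, pi_pos], hx.2⟩
    have h0 := hx.1
    have := auxH hx.1.le hx.2.le
    have e : (1 / sinc x + cos x) ^ 2 / 2 =
        (x + sin x * cos x) / sin x ^ 2 * ((x + sin x * cos x) / 2) := by
      rw [sinc_of_ne_zero h0.ne']
      field_simp
    rw [e, auxF]
    apply mul_le_mul_of_nonneg_left
    · linarith
    · positivity
  · filter_upwards [hev] with x hx
    have hs := sin_pos_of_pos_of_lt_pi hx.1 (by linarith [hx.2, pi_pos])
    have hc := cos_pos_of_mem_Ioo ⟨by linarith [hx.1, pi_pos], hx.2⟩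
    have h0 := hx.1
    have := auxG_le hx.1.le hx.2.le
    have e : (1 / sinc x + cos x) * (1 / sinc x) =
        (x + sin x * cos x) / sin x ^ 2 * x := by
      rw [sinc_of_ne_zero h0.ne']
      field_simp
    rw [e, auxF]
    apply mul_le_mul_of_nonneg_left this
    positivity

noncomputable def auxT (u : ℝ) : ℝ := 1 / (4 * sin u ^ 2)

lemma auxcov (f : ℝ → ℝ) : ∫ φ in (0:ℝ)..1, f (S φ) = 2 / π * ∫ u in (0:ℝ)..(π/2), f (auxT u) := by
  have := intervalIntegral.integral_comp_mul_left (a := 0) (b := 1) (c := π/2)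
    (fun u => f (auxT u)) (by positivity)
  simp only [mul_zero, mul_one, smul_eq_mul] at this
  rw [← inv_div, ← this]
  congr 1
  ext φ
  simp only [S, auxT]
  congr 5
  ring

lemma auxT_anti {x u : ℝ} (h0 : 0 < x) (h1 : x ≤ u) (h2 : u ≤ π/2) : auxT u ≤ auxT x := by
  have hs := sin_pos_of_pos_of_lt_pi h0 (by linarith [pi_pos])
  have := sin_le_sin_of_le_of_le_pi_div_two (by linarith [pi_pos]) h2 h1
  unfold auxT
  gcongr

lemma auxT_pos {x : ℝ} (h0 : 0 < x) (h1 : x ≤ π/2) : 0 < auxT x := by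
  have hs := sin_pos_of_pos_of_lt_pi h0 (by linarith [pi_pos])
  unfold auxT
  positivity

lemma auxD {x : ℝ} (h0 : 0 < x) (h1 : x ≤ π/2) :
    Dbar (auxT x) = (x + sin x * cos x) / (2 * π * sin x ^ 2) := by
  have hs := sin_pos_of_pos_of_lt_pi h0 (by linarith [pi_pos])
  have e1 : Set.EqOn (fun u => min (auxT u) (auxT x)) (fun _ => auxT x) (Set.uIoc 0 x) := by
    intro u hu
    rw [Set.uIoc_of_le h0.le] at hu
    exact min_eq_right (auxT_anti hu.1 hu.2 h1)
  have e2 : Set.EqOn (fun u => min (auxT u) (auxT x)) auxT (Set.uIoc x (π/2)) := by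
    intro u hu
    rw [Set.uIoc_of_le h1] at hu
    exact min_eq_left (auxT_anti h0 hu.1.le hu.2)
  have hcont : ContinuousOn auxT (Set.uIcc x (π/2)) := by
    unfold auxT
    apply ContinuousOn.div (by fun_prop) (by fun_prop)
    intro u hu
    rw [Set.uIcc_of_le h1] at hu
    have := sin_pos_of_pos_of_lt_pi (h0.trans_le hu.1) (by linarith [pi_pos, hu.2])
    positivity
  have i2 := hcont.intervalIntegrable (μ := volume)
  have i1 : IntervalIntegrable (fun _ => auxT x) volume 0 x := by simp
  have hI : ∫ u in x..(π/2), auxT u = cos x / (4 * sin x) := by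
    rw [intervalIntegral.integral_eq_sub_of_hasDerivAt (f := fun u => - (cos u / (4 * sin u)))
      _ i2]
    · simp
    · intro u hu
      rw [Set.uIcc_of_le h1] at hu
      have hu' := sin_pos_of_pos_of_lt_pi (h0.trans_le hu.1) (by linarith [pi_pos, hu.2])
      refine (((hasDerivAt_cos u).div ((hasDerivAt_sin u).const_mul 4) (by positivity)).neg).congr_deriv ?_
      unfold auxT
      field_simp
      nlinarith [sin_sq_add_cos_sq u]
  rw [Dbar, auxcov (fun s => min s (auxT x)),
    ← intervalIntegral.integral_add_adjacent_intervals (b := x) (i1.congr e1.symm) (i2.congr e2.symm),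
    auxcongr e1, auxcongr e2, hI]
  simp [auxT]
  field_simp
  ring

lemma auxlog {x : ℝ} (h0 : 0 < x) (h1 : x ≤ π/2) :
    log (auxT x) = - (2 * log 2) - 2 * log (sin x) := by
  have hs := sin_pos_of_pos_of_lt_pi h0 (by linarith [pi_pos])
  unfold auxT
  rw [one_div, log_inv, log_mul (by norm_num) (by positivity), log_pow,
    show (4:ℝ) = 2 ^ 2 by norm_num, log_pow]
  push_cast
  ring

lemma auxR {x : ℝ} (h0 : 0 < x) (h1 : x ≤ π/2) :
    Rbar (auxT x) = 2 / (π * log 2) * auxG x := by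
  have hs := sin_pos_of_pos_of_lt_pi h0 (by linarith [pi_pos])
  have hl2 : 0 < log 2 := log_pos (by norm_num)
  have hTx := auxT_pos h0 h1
  have e1 : Set.EqOn (fun u => max 0 (logb 2 (auxT u / auxT x)))
      (fun u => 2 / log 2 * (log (sin x) - log (sin u))) (Set.uIoc 0 x) := by
    intro u hu
    rw [Set.uIoc_of_le h0.le] at hu
    have hTu := auxT_pos hu.1 (hu.2.trans h1)
    have : 0 ≤ logb 2 (auxT u / auxT x) := by
      apply logb_nonneg (by norm_num)
      rw [le_div_iff₀ hTx, one_mul]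
      exact auxT_anti hu.1 hu.2 h1
    simp only [max_eq_right this]
    rw [logb, log_div hTu.ne' hTx.ne', auxlog h0 h1, auxlog hu.1 (hu.2.trans h1)]
    ring
  have e2 : Set.EqOn (fun u => max 0 (logb 2 (auxT u / auxT x))) (fun _ => 0)
      (Set.uIoc x (π/2)) := by
    intro u hu
    rw [Set.uIoc_of_le h1] at hu
    have hTu := auxT_pos (h0.trans hu.1) hu.2
    apply max_eq_left
    apply logb_nonpos (by norm_num) (by positivity)
    rw [div_le_one hTx]
    exact auxT_anti h0 hu.1.le hu.2
  have i2 : IntervalIntegrable (fun _ => (0:ℝ)) volume x (π/2) := by simp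
  have i0 : IntervalIntegrable (fun _ => log (sin x)) volume 0 x := by simp
  have i1 := (i0.sub (auxII 0 x)).const_mul (2 / log 2)
  rw [Rbar, auxcov (fun s => max 0 (logb 2 (s / auxT x))),
    ← intervalIntegral.integral_add_adjacent_intervals (b := x) (i1.congr e1.symm) (i2.congr e2.symm),
    auxcongr e1, auxcongr e2,
    intervalIntegral.integral_const_mul, intervalIntegral.integral_sub i0 (auxII 0 x)]
  simp [auxG]
  field_simp

lemma auxDR {x : ℝ} (h0 : 0 < x) (h1 : x ≤ π/2) :
    Dbar (auxT x) * Rbar (auxT x) = 1 / (π ^ 2 * log 2) * auxF x := by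
  have hs := sin_pos_of_pos_of_lt_pi h0 (by linarith [pi_pos])
  have hl2 : 0 < log 2 := log_pos (by norm_num)
  rw [auxD h0 h1, auxR h0 h1, auxF]
  field_simp

lemma auxT_ge {u : ℝ} (h0 : 0 < u) (h1 : u ≤ π/2) : 1/4 ≤ auxT u := by
  have := auxT_anti h0 h1 le_rfl
  simpa [auxT] using this

lemma auxDsmall {θ : ℝ} (h1 : θ ≤ 1/4) : Dbar θ = θ := by
  have e1 : Set.EqOn (fun u => min (auxT u) θ) (fun _ => θ) (Set.uIoc 0 (π/2)) := by
    intro u hu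
    rw [Set.uIoc_of_le (by positivity)] at hu
    exact min_eq_right (h1.trans (auxT_ge hu.1 hu.2))
  rw [Dbar, auxcov (fun s => min s θ), auxcongr e1]
  simp
  field_simp

lemma auxRsmall {θ : ℝ} (h0 : 0 < θ) (h1 : θ ≤ 1/4) : Rbar θ = - log θ / (2 * log 2) := by
  have hl2 : 0 < log 2 := log_pos (by norm_num)
  have e1 : Set.EqOn (fun u => max 0 (logb 2 (auxT u / θ)))
      (fun u => 1 / log 2 * ((- (2 * log 2) - log θ) - 2 * log (sin u))) (Set.uIoc 0 (π/2)) := by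
    intro u hu
    rw [Set.uIoc_of_le (by positivity)] at hu
    have hTu := auxT_pos hu.1 hu.2
    have : 0 ≤ logb 2 (auxT u / θ) := by
      apply logb_nonneg (by norm_num)
      rw [le_div_iff₀ h0, one_mul]
      exact h1.trans (auxT_ge hu.1 hu.2)
    simp only [max_eq_right this]
    rw [logb, log_div hTu.ne' h0.ne', auxlog hu.1 hu.2]
    ring
  rw [Rbar, auxcov (fun s => max 0 (logb 2 (s / θ))), auxcongr e1,
    intervalIntegral.integral_const_mul, intervalIntegral.integral_sub (by simp)
      ((auxII 0 (π/2)).const_mul 2), intervalIntegral.integral_const_mul,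
      integral_log_sin_zero_pi_div_two]
  simp
  field_simp
  ring

noncomputable def auxX (θ : ℝ) : ℝ := arcsin (1 / (2 * √θ))

lemma auxX_mem {θ : ℝ} (h : 1/4 ≤ θ) : auxX θ ∈ Set.Ioc 0 (π/2) := by
  have : 0 < √θ := sqrt_pos.2 (by linarith)
  exact ⟨arcsin_pos.2 (by positivity), arcsin_le_pi_div_two _⟩

lemma auxX_T {θ : ℝ} (h : 1/4 ≤ θ) : auxT (auxX θ) = θ := by
  have hp : 0 < √θ := sqrt_pos.2 (by linarith)
  have h2 : 1/2 ≤ √θ := by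
    apply le_sqrt_of_sq_le
    linarith
  unfold auxT auxX
  rw [sin_arcsin]
  · field_simp
    rw [sq_sqrt (by linarith)]
    try ring
  · have : 0 < 1 / (2 * √θ) := by positivity
    linarith
  · rw [div_le_one (by positivity)]; linarith

lemma auxX_anti : AntitoneOn auxX (Set.Ici (1/4)) := by
  intro a ha b hb hab
  have : 0 < √a := sqrt_pos.2 (by linarith [Set.mem_Ici.1 ha])
  unfold auxX
  apply monotone_arcsin
  gcongr

lemma auxX_tendsto : Tendsto auxX atTop (nhdsWithin 0 (Set.Ioi 0)) := by
  apply tendsto_nhdsWithin_iff.2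
  refine ⟨?_, ?_⟩
  · have h1 : Tendsto (fun θ : ℝ => 1 / (2 * √θ)) atTop (nhds 0) := by
      apply Tendsto.div_atTop tendsto_const_nhds
      exact tendsto_sqrt_atTop.const_mul_atTop (by norm_num)
    have := (continuous_arcsin.tendsto 0).comp h1
    rw [arcsin_zero] at this
    exact this
  · filter_upwards [eventually_ge_atTop (1/4)] with θ h
    exact (auxX_mem h).1

lemma auxP {θ : ℝ} (h : 1/4 ≤ θ) :
    Dbar θ * Rbar θ = 1 / (π ^ 2 * log 2) * auxF (auxX θ) := by
  have := auxDR (auxX_mem h).1 (auxX_mem h).2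
  rwa [auxX_T h] at this

lemma auxmono1 : MonotoneOn (fun θ : ℝ => Dbar θ * Rbar θ) (Set.Ioc 0 (1/4)) := by
  have hl2 : 0 < log 2 := log_pos (by norm_num)
  have key : MonotoneOn (fun θ : ℝ => θ * (- log θ / (2 * log 2))) (Set.Ioc 0 (1/4)) := by
    apply monotoneOn_of_hasDerivWithinAt_nonneg (convex_Ioc _ _)
      (f' := fun θ => (- log θ - 1) / (2 * log 2))
    · apply ContinuousOn.mul continuousOn_id
      apply ContinuousOn.div_const
      apply ContinuousOn.neg
      exact continuousOn_log.mono (fun x hx => hx.1.ne')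
    · intro x hx
      rw [interior_Ioc] at hx
      have h0 := hx.1
      refine (((hasDerivAt_id x).mul
        ((hasDerivAt_log h0.ne').neg.div_const (2 * log 2))).congr_deriv ?_).hasDerivWithinAt
      simp only [id, Pi.neg_apply]
      field_simp
      try ring
    · intro x hx
      rw [interior_Ioc] at hx
      have : log x ≤ -1 := by
        rw [log_le_iff_le_exp hx.1, exp_neg]
        refine hx.2.le.trans ?_
        rw [one_div]
        apply inv_anti₀ (exp_pos _)
        linarith [exp_one_lt_d9]
      apply div_nonneg <;> linarith
  refine key.congr ?_
  intro θ h
  simp only [auxDsmall h.2, auxRsmall h.1 h.2]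

lemma auxmono : MonotoneOn (fun θ : ℝ => Dbar θ * Rbar θ) (Set.Ioi 0) := by
  have hl2 : 0 < log 2 := log_pos (by norm_num)
  have h2 : MonotoneOn (fun θ : ℝ => Dbar θ * Rbar θ) (Set.Ici (1/4)) := by
    intro a ha b hb hab
    simp only [auxP ha, auxP hb]
    apply mul_le_mul_of_nonneg_left _ (by positivity)
    exact auxF_anti (auxX_mem hb) (auxX_mem ha) (auxX_anti ha hb hab)
  have := auxmono1.union_right h2 (isGreatest_Ioc (by norm_num)) isLeast_Ici
  rwa [Set.Ioc_union_Ici_eq_Ioi (by norm_num)] at this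

lemma auxtend : Tendsto (fun θ : ℝ => Dbar θ * Rbar θ) atTop (nhds (2 / (π ^ 2 * log 2))) := by
  have := (auxF_tendsto.comp auxX_tendsto).const_mul (1 / (π ^ 2 * log 2))
  rw [show 1 / (π ^ 2 * log 2) * 2 = 2 / (π ^ 2 * log 2) by ring] at this
  refine this.congr' ?_
  filter_upwards [eventually_ge_atTop (1/4)] with θ h
  exact (auxP h).symm

/-- `θ ↦ D̄(θ)·R̄(θ)` is nondecreasing on `(0,∞)` and its supremum over `θ > 0`
equals `2/(π² ln 2)`. -/
theorem stmt1 :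
    MonotoneOn (fun θ : ℝ => Dbar θ * Rbar θ) (Set.Ioi 0) ∧
      IsLUB ((fun θ : ℝ => Dbar θ * Rbar θ) '' Set.Ioi 0)
        (2 / (Real.pi ^ 2 * Real.log 2)) := by
  refine ⟨auxmono, ?_, ?_⟩
  · rintro _ ⟨θ, hθ, rfl⟩
    apply ge_of_tendsto auxtend
    filter_upwards [eventually_ge_atTop θ] with t ht
    exact auxmono hθ (lt_of_lt_of_le hθ ht) ht
  · intro b hb
    apply le_of_tendsto auxtend
    filter_upwards [eventually_gt_atTop 0] with t ht
    exact hb ⟨t, ht, rfl⟩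
end

section
/- Fix an integer N ≥ 1. For every k ∈ {1,…,N} and every n ∈ {1,…,N}, the N×N matrix Σ with entries Σ_{n,m} = min(n,m) satisfies Σ_{m=1}^N min(n,m)·sin((2k−1)·π·m/(2N+1)) = λ_k · sin((2k−1)·π·n/(2N+1)), where λ_k = 1/(4·sin²((2k−1)·π/(2·(2N+1)))). That is, the vectors (sin((2k−1)πn/(2N+1)))_{n=1}^N are eigenvectors of the covariance matrix of the discrete-time Wiener process, with eigenvalues λ_k. -/
open Real

theorem aux_step (h x : ℝ) : 4 * Real.sin h ^ 2 * Real.sin (2 * h * x) =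
    2 * Real.sin (2 * h * x) - Real.sin (2 * h * (x + 1)) - Real.sin (2 * h * (x - 1)) := by
  have e1 : 2 * h * (x + 1) = 2 * h * x + 2 * h := by ring
  have e2 : 2 * h * (x - 1) = 2 * h * x - 2 * h := by ring
  rw [e1, e2, Real.sin_add, Real.sin_sub, Real.cos_two_mul, Real.cos_sq']
  ring

theorem aux_low (h : ℝ) (n M : ℕ) (hM : M ≤ n) :
    4 * Real.sin h ^ 2 * ∑ m ∈ Finset.Icc 1 M, min (n : ℝ) (m : ℝ) * Real.sin (2 * h * m) =
      (M + 1) * Real.sin (2 * h * M) - M * Real.sin (2 * h * (M + 1)) := by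
  induction M with
  | zero => simp
  | succ M ih =>
    have hc : ((M + 1 : ℕ) : ℝ) ≤ n := by exact_mod_cast hM
    rw [Finset.sum_Icc_succ_top (by omega), mul_add, ih (by omega), min_eq_right hc]
    have := aux_step h ((M + 1 : ℕ) : ℝ)
    push_cast at this ⊢
    rw [add_sub_cancel_right] at this
    linear_combination ((M : ℝ) + 1) * this

theorem aux_high (h : ℝ) (n M : ℕ) (hM : n ≤ M) :
    4 * Real.sin h ^ 2 * ∑ m ∈ Finset.Icc 1 M, min (n : ℝ) (m : ℝ) * Real.sin (2 * h * m) =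
      Real.sin (2 * h * n) + n * (Real.sin (2 * h * M) - Real.sin (2 * h * (M + 1))) := by
  induction M, hM using Nat.le_induction with
  | base => rw [aux_low h n n le_rfl]; ring
  | succ M hM ih =>
    have hc : (n : ℝ) ≤ ((M + 1 : ℕ) : ℝ) := by exact_mod_cast (by omega : n ≤ M + 1)
    rw [Finset.sum_Icc_succ_top (by omega), mul_add, ih, min_eq_left hc]
    have := aux_step h ((M + 1 : ℕ) : ℝ)
    push_cast at this ⊢
    rw [add_sub_cancel_right] at this
    linear_combination (n : ℝ) * this

/-- The vectors `(sin((2k−1)πn/(2N+1)))ₙ` are eigenvectors of the covariance matrix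
`(min(n,m))` of the discrete-time Wiener process, with eigenvalues
`λ_k = 1/(4 sin²((2k−1)π/(2(2N+1))))`. -/
theorem stmt2 (N : ℕ) (hN : 1 ≤ N) (k n : ℕ)
    (hk : k ∈ Finset.Icc 1 N) (hn : n ∈ Finset.Icc 1 N) :
    ∑ m ∈ Finset.Icc 1 N,
        (min (n : ℝ) (m : ℝ)) * Real.sin ((2 * (k : ℝ) - 1) * Real.pi * (m : ℝ) / (2 * (N : ℝ) + 1))
      = (1 / (4 * Real.sin ((2 * (k : ℝ) - 1) * Real.pi / (2 * (2 * (N : ℝ) + 1))) ^ 2)) *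
          Real.sin ((2 * (k : ℝ) - 1) * Real.pi * (n : ℝ) / (2 * (N : ℝ) + 1)) := by
  obtain ⟨hk1, hk2⟩ := Finset.mem_Icc.mp hk
  obtain ⟨hn1, hn2⟩ := Finset.mem_Icc.mp hn
  have hD : (0 : ℝ) < 2 * (N : ℝ) + 1 := by positivity
  have hk1' : (1 : ℝ) ≤ k := by exact_mod_cast hk1
  have hk2' : (k : ℝ) ≤ N := by exact_mod_cast hk2
  set h := (2 * (k : ℝ) - 1) * Real.pi / (2 * (2 * (N : ℝ) + 1)) with hh
  have harg : ∀ x : ℝ, (2 * (k : ℝ) - 1) * Real.pi * x / (2 * (N : ℝ) + 1) = 2 * h * x := by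
    intro x
    rw [hh]
    field_simp
  have hs : 0 < Real.sin h := by
    apply Real.sin_pos_of_pos_of_lt_pi
    · have : 0 < 2 * (k : ℝ) - 1 := by linarith
      have := Real.pi_pos
      positivity
    · rw [hh, div_lt_iff₀ (by positivity)]
      nlinarith [Real.pi_pos]
  simp only [harg]
  have key := aux_high h n N hn2
  have hb : Real.sin (2 * h * (N + 1)) = Real.sin (2 * h * N) := by
    have e : 2 * h * ((N : ℝ) + 1) = (Real.pi - 2 * h * N) + ((k - 1 : ℤ) : ℝ) * (2 * Real.pi) := by
      rw [hh]
      push_cast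
      field_simp
      ring
    rw [e, Real.sin_add_int_mul_two_pi, Real.sin_pi_sub]
  rw [hb, sub_self, mul_zero, add_zero] at key
  rw [← key]
  field_simp
end

section
/- Fix σ > 0 and T_s > 0. For integers N ≥ 1 and 1 ≤ k ≤ N let λ_k^{(N)} := (σ²·T_s²/6)·(2·cos(kπ) − sin((2k−1)(N−1)π/(2N)))/(cos(kπ) + sin((2k−1)(N−1)π/(2N))). Then for any φ ∈ (0,1) and any sequence of integers k_N with 1 ≤ k_N ≤ N and k_N/N → φ, the eigenvalues satisfy λ_{k_N}^{(N)} → σ²·T_s²·(2 + cos(πφ))/(6·(1 − cos(πφ))) as N → ∞, and this limit equals σ²·T_s²·(S(φ) − 1/6) where S(φ) := 1/(4·sin²(πφ/2)). -/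
open Real Filter

/-- Limiting density of the Karhunen–Loève eigenvalues of the interpolated sample
process: if `k_N / N → φ ∈ (0,1)` then `λ_{k_N}^{(N)} → σ² T_s² (2 + cos(πφ))/(6(1 − cos(πφ)))`,
and this limit equals `σ² T_s² (S(φ) − 1/6)`. -/
theorem stmt4 (σ Ts : ℝ) (hσ : 0 < σ) (hTs : 0 < Ts)
    (lam : ℕ → ℕ → ℝ)
    (hlam : ∀ N k, lam N k = (σ ^ 2 * Ts ^ 2 / 6) *
      (2 * Real.cos ((k : ℝ) * Real.pi)
        - Real.sin ((2 * (k : ℝ) - 1) * ((N : ℝ) - 1) * Real.pi / (2 * (N : ℝ)))) /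
      (Real.cos ((k : ℝ) * Real.pi)
        + Real.sin ((2 * (k : ℝ) - 1) * ((N : ℝ) - 1) * Real.pi / (2 * (N : ℝ)))))
    (φ : ℝ) (hφ : φ ∈ Set.Ioo (0 : ℝ) 1)
    (k : ℕ → ℕ) (hk : ∀ N, 1 ≤ N → 1 ≤ k N ∧ k N ≤ N)
    (hklim : Tendsto (fun N : ℕ => (k N : ℝ) / (N : ℝ)) atTop (nhds φ)) :
    Tendsto (fun N : ℕ => lam N (k N)) atTop
      (nhds (σ ^ 2 * Ts ^ 2 * (2 + Real.cos (Real.pi * φ))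
        / (6 * (1 - Real.cos (Real.pi * φ)))))
    ∧ σ ^ 2 * Ts ^ 2 * (2 + Real.cos (Real.pi * φ)) / (6 * (1 - Real.cos (Real.pi * φ)))
        = σ ^ 2 * Ts ^ 2 * (S φ - 1 / 6) := by
  have hc1 : Real.cos (Real.pi * φ) < 1 := by
    have h := Real.cos_lt_cos_of_nonneg_of_le_pi (x := 0) (y := Real.pi * φ) le_rfl
      (by nlinarith [Real.pi_pos, hφ.2]) (mul_pos Real.pi_pos hφ.1)
    simpa using h
  have hne : 1 - Real.cos (Real.pi * φ) ≠ 0 := by linarith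
  refine ⟨?_, ?_⟩
  · have hθ : Tendsto (fun N : ℕ => Real.pi * ((k N : ℝ) / (N : ℝ))
        - Real.pi / 2 * (1 / (N : ℝ))) atTop (nhds (Real.pi * φ)) := by
      have h := (hklim.const_mul Real.pi).sub
        ((tendsto_one_div_atTop_nhds_zero_nat (𝕜 := ℝ)).const_mul (Real.pi / 2))
      simpa using h
    have hcos := (Real.continuous_cos.tendsto (Real.pi * φ)).comp hθ
    have hlim := (((hcos.const_add 2).const_mul (σ ^ 2 * Ts ^ 2)).div
      ((hcos.const_sub 1).const_mul 6) (by simpa using hne))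
    refine hlim.congr' ?_
    filter_upwards [eventually_ge_atTop 1] with N hN
    have hN0 : (N : ℝ) ≠ 0 := by positivity
    simp only [Pi.div_apply, Function.comp_apply]
    rw [hlam]
    set θ := Real.pi * ((k N : ℝ) / (N : ℝ)) - Real.pi / 2 * (1 / (N : ℝ)) with hθd
    have e : (2 * (k N : ℝ) - 1) * ((N : ℝ) - 1) * Real.pi / (2 * (N : ℝ))
        = (k N : ℝ) * Real.pi - (θ + Real.pi / 2) := by
      rw [hθd]; field_simp; ring
    have hC : Real.cos ((k N : ℝ) * Real.pi) ≠ 0 := by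
      rw [Real.cos_nat_mul_pi]
      exact pow_ne_zero _ (by norm_num)
    rw [e, Real.sin_sub, Real.sin_nat_mul_pi, Real.sin_add_pi_div_two]
    generalize Real.cos ((k N : ℝ) * Real.pi) = C at hC
    have e1 : σ ^ 2 * Ts ^ 2 / 6 * (2 * C - (0 * Real.cos (θ + Real.pi / 2) - C * Real.cos θ))
        = C * (σ ^ 2 * Ts ^ 2 / 6 * (2 + Real.cos θ)) := by ring
    have e2 : C + (0 * Real.cos (θ + Real.pi / 2) - C * Real.cos θ)
        = C * (1 - Real.cos θ) := by ring
    rw [e1, e2, mul_div_mul_left _ _ hC, ← div_div]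
    ring
  · have h2 : Real.sin (Real.pi * φ / 2) ^ 2 = (1 - Real.cos (Real.pi * φ)) / 2 := by
      rw [Real.sin_sq_eq_half_sub]
      rw [show 2 * (Real.pi * φ / 2) = Real.pi * φ by ring]
      ring
    unfold S
    rw [h2]
    field_simp
    ring
end

section
/- Let θ satisfy 0 < θ ≤ 1/12, and let R̃(θ) := (1/2)·∫₀¹ log₂((S(φ) − 1/6)/θ) dφ (no positive-part truncation is needed since S(φ) − 1/6 ≥ 1/12 ≥ θ for all φ ∈ (0,1]). Then θ = ((2+√3)/6)·2^{−2·R̃(θ)}. Consequently, in this low-sampling-rate regime the indirect distortion-rate function of the Wiener process given its rate-f_s samples takes the closed form D(f_s,R) = (σ²/f_s)·(1/6 + ((2+√3)/6)·2^{−2R/f_s}). -/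
open Real MeasureTheory

/-- The parametric rate `R̃(θ)`, stated here without positive-part truncation
(valid since `S(φ) − 1/6 ≥ 1/12 ≥ θ` for all `φ ∈ (0,1]`). -/
noncomputable def RtildeNoTrunc (θ : ℝ) : ℝ :=
  (1 / 2) * ∫ φ in (0:ℝ)..1, Real.logb 2 ((S φ - 1 / 6) / θ)

lemma aux_full (a : ℝ) :
    ∫ x in (0:ℝ)..(2 * π), Real.log (1 + a ^ 2 - 2 * a * Real.cos x) = 4 * π * log⁺ |a| := by
  have h := circleAverage_log_norm_sub_const_eq_posLog (a := (a : ℂ))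
  rw [Real.circleAverage_def, smul_eq_mul] at h
  have hn : ∀ x : ℝ, Real.log ‖circleMap 0 1 x - (a : ℂ)‖
      = (1 / 2) * Real.log (1 + a ^ 2 - 2 * a * Real.cos x) := by
    intro x
    have h2 : ‖circleMap 0 1 x - (a : ℂ)‖ ^ 2 = 1 + a ^ 2 - 2 * a * Real.cos x := by
      rw [← Complex.normSq_eq_norm_sq, Complex.normSq_apply]
      simp only [circleMap, Complex.exp_ofReal_mul_I_re, Complex.exp_ofReal_mul_I_im, zero_add,
        Complex.ofReal_one, one_mul, Complex.sub_re, Complex.sub_im, Complex.ofReal_re,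
        Complex.ofReal_im]
      nlinarith [Real.sin_sq_add_cos_sq x]
    rw [← h2, Real.log_pow]
    push_cast
    ring
  simp only [hn] at h
  rw [intervalIntegral.integral_const_mul, Complex.norm_real, Real.norm_eq_abs] at h
  have hp := Real.pi_pos
  field_simp at h
  linarith

lemma aux_int (a u v : ℝ) :
    IntervalIntegrable (fun x => Real.log (1 + a ^ 2 - 2 * a * Real.cos x)) volume u v := by
  apply MeromorphicOn.intervalIntegrable_log (f := fun x => 1 + a ^ 2 - 2 * a * Real.cos x)
  intro x _
  apply AnalyticAt.meromorphicAt
  have : AnalyticAt ℝ Real.cos x := Real.analyticAt_cos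
  fun_prop

lemma aux_half (a : ℝ) :
    ∫ x in (0:ℝ)..π, Real.log (1 + a ^ 2 - 2 * a * Real.cos x) = 2 * π * log⁺ |a| := by
  have h := aux_full a
  rw [← intervalIntegral.integral_add_adjacent_intervals (aux_int a 0 π) (aux_int a π (2 * π))] at h
  have h2 := intervalIntegral.integral_comp_sub_left (a := 0) (b := π)
    (fun x => Real.log (1 + a ^ 2 - 2 * a * Real.cos x)) (2 * π)
  simp only [Real.cos_two_pi_sub, sub_zero, show 2 * π - π = π by ring] at h2
  linarith

lemma aux_unit (a : ℝ) :
    ∫ x in (0:ℝ)..1, Real.log (1 + a ^ 2 - 2 * a * Real.cos (π * x)) = 2 * log⁺ |a| := by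
  have h2 := intervalIntegral.integral_comp_mul_left (a := 0) (b := 1)
    (fun x => Real.log (1 + a ^ 2 - 2 * a * Real.cos x)) Real.pi_ne_zero
  rw [h2, mul_zero, mul_one, aux_half, smul_eq_mul]
  have := Real.pi_pos
  field_simp

lemma aux_unit_int (a : ℝ) :
    IntervalIntegrable (fun x => Real.log (1 + a ^ 2 - 2 * a * Real.cos (π * x))) volume 0 1 := by
  apply MeromorphicOn.intervalIntegrable_log (f := fun x => 1 + a ^ 2 - 2 * a * Real.cos (π * x))
  intro x _
  apply AnalyticAt.meromorphicAt
  have : AnalyticAt ℝ (fun x => Real.cos (π * x)) x :=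
    AnalyticAt.fun_comp (g := Real.cos) Real.analyticAt_cos (by fun_prop)
  fun_prop

lemma aux_main (θ : ℝ) (hθ0 : 0 < θ) :
    ∫ φ in (0:ℝ)..1, Real.logb 2 ((S φ - 1 / 6) / θ)
      = (Real.log (2 + √3) - Real.log (6 * θ)) / Real.log 2 := by
  have h3 : √3 ^ 2 = 3 := Real.sq_sqrt (by norm_num)
  have hs : 0 ≤ √3 := Real.sqrt_nonneg 3
  set a : ℝ := 2 + √3 with ha
  have ha2 : a ^ 2 = 4 * a - 1 := by rw [ha]; nlinarith
  have ha0 : 0 < a := by rw [ha]; linarith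
  have hc : ∀ φ ∈ Set.uIoc (0:ℝ) 1, Real.logb 2 ((S φ - 1 / 6) / θ) =
      (Real.log (1 + (-a) ^ 2 - 2 * (-a) * Real.cos (π * φ))
        - Real.log (1 + 1 ^ 2 - 2 * 1 * Real.cos (π * φ)) - (Real.log a + Real.log (6 * θ)))
        / Real.log 2 := by
    intro φ hφ
    rw [Set.uIoc_of_le zero_le_one] at hφ
    have hp := Real.pi_pos
    have hsin : 0 < Real.sin (π * φ / 2) := by
      apply Real.sin_pos_of_pos_of_lt_pi
      · have := mul_pos hp hφ.1
        linarith
      · nlinarith [hφ.2]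
    have hcs : 4 * Real.sin (π * φ / 2) ^ 2 = 1 + 1 ^ 2 - 2 * 1 * Real.cos (π * φ) := by
      have h1 := Real.cos_sq (π * φ / 2)
      rw [show 2 * (π * φ / 2) = π * φ by ring] at h1
      nlinarith [Real.sin_sq_add_cos_sq (π * φ / 2)]
    have hpos : 0 < 1 + 1 ^ 2 - 2 * 1 * Real.cos (π * φ) := by rw [← hcs]; positivity
    have hnum : 1 + (-a) ^ 2 - 2 * (-a) * Real.cos (π * φ) = a * (4 + 2 * Real.cos (π * φ)) := by
      linear_combination ha2
    have hpos2 : 0 < 4 + 2 * Real.cos (π * φ) := by linarith [Real.neg_one_le_cos (π * φ)]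
    have : (S φ - 1 / 6) / θ = (1 + (-a) ^ 2 - 2 * (-a) * Real.cos (π * φ)) /
        (1 + 1 ^ 2 - 2 * 1 * Real.cos (π * φ)) / (a * (6 * θ)) := by
      rw [hnum, S, hcs]
      have := hpos.ne'
      generalize Real.cos (π * φ) = c at *
      rw [div_sub_div _ _ this (by norm_num), div_div, div_div,
        div_eq_div_iff (by positivity) (by positivity)]
      ring
    rw [Real.logb, this, Real.log_div (by rw [hnum]; positivity) (by positivity),
      Real.log_div (by rw [hnum]; positivity) hpos.ne', Real.log_mul ha0.ne' (by positivity)]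
  rw [intervalIntegral.integral_congr_ae (Filter.Eventually.of_forall hc), intervalIntegral.integral_div,
    intervalIntegral.integral_sub ((aux_unit_int (-a)).sub (aux_unit_int 1)) (by simp),
    intervalIntegral.integral_sub (aux_unit_int (-a)) (aux_unit_int 1), aux_unit, aux_unit]
  have hl : log⁺ |(-a)| = Real.log a := by
    rw [abs_neg, abs_of_pos ha0, Real.posLog_eq_log]
    rw [abs_of_pos ha0, ha]; linarith
  rw [hl]
  simp
  ring

theorem stmt5 (θ : ℝ) (hθ0 : 0 < θ) (hθ : θ ≤ 1 / 12) :
    θ = ((2 + Real.sqrt 3) / 6) * (2 : ℝ) ^ (-(2 * RtildeNoTrunc θ)) := by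
  have hs : 0 ≤ √3 := Real.sqrt_nonneg 3
  have hl : Real.log 2 ≠ 0 := (Real.log_pos (by norm_num)).ne'
  rw [RtildeNoTrunc, aux_main θ hθ0, Real.rpow_def_of_pos (by norm_num)]
  have : Real.log 2 * -(2 * (1 / 2 * ((Real.log (2 + √3) - Real.log (6 * θ)) / Real.log 2)))
      = Real.log (6 * θ) - Real.log (2 + √3) := by
    field_simp
    ring
  rw [this, Real.exp_sub, Real.exp_log (by positivity), Real.exp_log (by positivity)]
  have : 2 + √3 ≠ 0 := by positivity
  field_simp
end

section
/- Let θ satisfy 0 < θ ≤ 1/4. Then D̄(θ) = θ and R̄(θ) = −(1/2)·log₂ θ; equivalently θ = 2^{−2·R̄(θ)}. Consequently, whenever the number of bits per sample R/f_s is at least 1, the distortion-rate function of the sampled Wiener process takes the closed form D_{W̄}(R/f_s) = (σ²/f_s)·2^{−2R/f_s}, and the estimate-and-compress upper bound equals D^U(f_s,R) = σ²/(6f_s) + (σ²/f_s)·2^{−2R/f_s}. -/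
open Real MeasureTheory

theorem S_ge_aux (φ : ℝ) (h0 : 0 < φ) (h1 : φ ≤ 1) :
    0 < Real.sin (Real.pi * φ / 2) ∧ 1 / 4 ≤ S φ := by
  have hp := Real.pi_pos
  have hs : 0 < Real.sin (Real.pi * φ / 2) := by
    apply Real.sin_pos_of_pos_of_lt_pi
    · positivity
    · nlinarith
  refine ⟨hs, ?_⟩
  unfold S
  apply one_div_le_one_div_of_le
  · positivity
  · nlinarith [Real.sin_sq_le_one (Real.pi * φ / 2)]

theorem Dbar_aux (θ : ℝ) (hθ : θ ≤ 1 / 4) : Dbar θ = θ := by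
  unfold Dbar
  have : ∫ φ in (0:ℝ)..1, min (S φ) θ = ∫ φ in (0:ℝ)..1, θ := by
    apply intervalIntegral.integral_congr_ae
    filter_upwards with φ hφ
    rw [Set.uIoc_of_le zero_le_one] at hφ
    exact min_eq_right (hθ.trans (S_ge_aux φ hφ.1 hφ.2).2)
  rw [this]
  simp

theorem log_sin_aux : IntervalIntegrable (fun φ => Real.log (Real.sin (Real.pi / 2 * φ))) volume 0 1 ∧
    ∫ φ in (0:ℝ)..1, Real.log (Real.sin (Real.pi / 2 * φ)) = - Real.log 2 := by
  have hp := Real.pi_pos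
  have hc : Real.pi / 2 ≠ 0 := by positivity
  constructor
  · have h : IntervalIntegrable (fun x => Real.log (Real.sin x)) volume 0 (Real.pi / 2) :=
      intervalIntegrable_log_sin
    have := h.comp_mul_left (c := Real.pi / 2)
    simpa [hc] using this
  · have := intervalIntegral.integral_comp_mul_left (a := 0) (b := 1)
      (fun x => Real.log (Real.sin x)) hc
    rw [this, mul_zero, mul_one, integral_log_sin_zero_pi_div_two, smul_eq_mul]
    field_simp

theorem Rbar_aux (θ : ℝ) (hθ0 : 0 < θ) (hθ : θ ≤ 1 / 4) :
    Rbar θ = -(1 / 2) * Real.logb 2 θ := by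
  unfold Rbar
  have hl : 0 < Real.log 2 := Real.log_pos one_lt_two
  have : ∫ φ in (0:ℝ)..1, max 0 (Real.logb 2 (S φ / θ)) = ∫ φ in (0:ℝ)..1,
      ((-2 - Real.logb 2 θ) - 2 / Real.log 2 * Real.log (Real.sin (Real.pi / 2 * φ))) := by
    apply intervalIntegral.integral_congr_ae
    filter_upwards with φ hφ
    rw [Set.uIoc_of_le zero_le_one] at hφ
    obtain ⟨hs, hS⟩ := S_ge_aux φ hφ.1 hφ.2
    have h1 : 1 ≤ S φ / θ := by
      rw [le_div_iff₀ hθ0]; linarith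
    rw [max_eq_right (Real.logb_nonneg one_lt_two h1)]
    have h4 : Real.log 4 = 2 * Real.log 2 := by
      rw [show (4:ℝ) = 2 ^ 2 by norm_num, Real.log_pow]; norm_num
    have e : Real.pi / 2 * φ = Real.pi * φ / 2 := by ring
    rw [e]
    unfold Real.logb
    rw [Real.log_div (by linarith) hθ0.ne']
    unfold S
    rw [one_div, Real.log_inv, Real.log_mul (by norm_num) (by positivity), Real.log_pow, h4]
    push_cast
    field_simp
    ring
  obtain ⟨hi, hv⟩ := log_sin_aux
  rw [this, intervalIntegral.integral_sub (by simp) (hi.const_mul _),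
    intervalIntegral.integral_const_mul, hv]
  simp only [intervalIntegral.integral_const, smul_eq_mul]
  field_simp
  ring

/-- For `0 < θ ≤ 1/4` (at least one bit per sample) the waterfilling formulas reduce to
`D̄(θ) = θ` and `R̄(θ) = −(1/2)log₂ θ`, i.e. `θ = 2^{−2R̄(θ)}`.  This yields the closed
form `D_{W̄}(R/f_s) = (σ²/f_s)·2^{−2R/f_s}` and the estimate-and-compress bound
`D^U(f_s,R) = σ²/(6f_s) + (σ²/f_s)·2^{−2R/f_s}` whenever `R/f_s ≥ 1`. -/
theorem stmt7 (θ : ℝ) (hθ0 : 0 < θ) (hθ : θ ≤ 1 / 4) :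
    Dbar θ = θ ∧ Rbar θ = -(1 / 2) * Real.logb 2 θ ∧
      θ = (2 : ℝ) ^ (-(2 * Rbar θ)) := by
  have hR := Rbar_aux θ hθ0 hθ
  refine ⟨Dbar_aux θ hθ, hR, ?_⟩
  rw [hR, show -(2 * (-(1 / 2) * Real.logb 2 θ)) = Real.logb 2 θ by ring]
  exact (Real.rpow_logb two_pos (by norm_num) hθ0).symm
end

section
/- Let θ satisfy 0 < θ ≤ 1/4. Then ∫₀¹ min{θ, S(φ)}·(S(φ) − 1/6)/S(φ) dφ = (2/3)·θ. Consequently, since θ = 2^{−2·R̄(θ)} in this regime, whenever R ≥ f_s the compress-and-estimate distortion takes the closed form D_CE(f_s,R) = σ²/(6f_s) + (2/(3f_s))·σ²·2^{−2R/f_s}. -/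
open Real MeasureTheory

/-- Normalized compress-and-estimate distortion integral. -/
noncomputable def DCEint (θ : ℝ) : ℝ :=
  ∫ φ in (0:ℝ)..1, min θ (S φ) * (S φ - 1 / 6) / S φ

lemma S_facts (φ : ℝ) (h : φ ∈ Set.uIoc (0:ℝ) 1) :
    0 < Real.sin (Real.pi / 2 * φ) ∧ S φ = 1 / (4 * Real.sin (Real.pi / 2 * φ) ^ 2) ∧ 1/4 ≤ S φ := by
  rw [Set.uIoc_of_le zero_le_one] at h
  have hp := Real.pi_pos
  have h0 : 0 < Real.sin (Real.pi / 2 * φ) := by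
    apply Real.sin_pos_of_pos_of_lt_pi
    · exact mul_pos (by positivity) h.1
    · nlinarith [h.2]
  have h1 : S φ = 1 / (4 * Real.sin (Real.pi / 2 * φ) ^ 2) := by
    unfold S
    rw [show Real.pi * φ / 2 = Real.pi / 2 * φ by ring]
  refine ⟨h0, h1, ?_⟩
  rw [h1]
  apply one_div_le_one_div_of_le (by positivity)
  nlinarith [Real.sin_sq_le_one (Real.pi / 2 * φ)]

lemma DCE_eq (θ : ℝ) (hθ : θ ≤ 1 / 4) : DCEint θ = (2 / 3) * θ := by
  unfold DCEint
  have : ∫ φ in (0:ℝ)..1, min θ (S φ) * (S φ - 1 / 6) / S φ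
      = ∫ φ in (0:ℝ)..1, (θ - (2/3*θ) * Real.sin (Real.pi / 2 * φ) ^ 2) := by
    apply intervalIntegral.integral_congr_ae
    refine Filter.Eventually.of_forall fun φ h => ?_
    obtain ⟨h0, h1, h2⟩ := S_facts φ h
    rw [min_eq_left (hθ.trans h2), h1]
    clear h1 h2
    generalize Real.sin (Real.pi / 2 * φ) = s at h0 ⊢
    field_simp
    ring
  have hp := Real.pi_pos.ne'
  rw [this, intervalIntegral.integral_sub (by simp)
    (Continuous.intervalIntegrable (by fun_prop) _ _), intervalIntegral.integral_const_mul,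
    intervalIntegral.integral_comp_mul_left (fun x => Real.sin x ^ 2) (by positivity), integral_sin_sq]
  simp
  field_simp
  ring

lemma Rbar_eq (θ : ℝ) (hθ0 : 0 < θ) (hθ : θ ≤ 1 / 4) : -(2 * Rbar θ) = Real.logb 2 θ := by
  unfold Rbar
  have hl : 0 < Real.log 2 := Real.log_pos (by norm_num)
  have : ∫ φ in (0:ℝ)..1, max 0 (Real.logb 2 (S φ / θ))
      = ∫ φ in (0:ℝ)..1, ((-2 - Real.logb 2 θ) - (2 / Real.log 2) * Real.log (Real.sin (Real.pi / 2 * φ))) := by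
    apply intervalIntegral.integral_congr_ae
    refine Filter.Eventually.of_forall fun φ h => ?_
    obtain ⟨h0, h1, h2⟩ := S_facts φ h
    rw [max_eq_right (Real.logb_nonneg (by norm_num) ((one_le_div hθ0).2 (hθ.trans h2))), h1]
    unfold Real.logb
    rw [Real.log_div (by positivity) hθ0.ne', one_div, Real.log_inv,
      Real.log_mul (by norm_num) (by positivity), Real.log_pow,
      show (4:ℝ) = 2 ^ 2 by norm_num, Real.log_pow]
    field_simp
    push_cast
    ring
  have hp := Real.pi_pos.ne'
  have hi : IntervalIntegrable (fun φ => Real.log (Real.sin (Real.pi / 2 * φ))) volume 0 1 := by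
    have h : IntervalIntegrable (Real.log ∘ Real.sin) volume 0 (Real.pi/2) := intervalIntegrable_log_sin
    have := h.comp_mul_left (c := Real.pi / 2)
    simpa [hp] using this
  rw [this, intervalIntegral.integral_sub (by simp) (hi.const_mul _), intervalIntegral.integral_const_mul,
    intervalIntegral.integral_comp_mul_left (fun x => Real.log (Real.sin x)) (by positivity),
    mul_zero, mul_one, integral_log_sin_zero_pi_div_two]
  simp
  field_simp
  ring


/-- For `0 < θ ≤ 1/4` one has `∫₀¹ min{θ,S(φ)}(S(φ)−1/6)/S(φ) dφ = (2/3)θ`; combined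
with `θ = 2^{−2R̄(θ)}` this gives the low-sampling-rate closed form
`D_CE(f_s,R) = σ²/(6f_s) + (2σ²/(3f_s))·2^{−2R/f_s}` whenever `R ≥ f_s`. -/
theorem stmt8 (θ : ℝ) (hθ0 : 0 < θ) (hθ : θ ≤ 1 / 4) :
    DCEint θ = (2 / 3) * θ ∧
      DCEint θ = (2 / 3) * (2 : ℝ) ^ (-(2 * Rbar θ)) := by
  refine ⟨DCE_eq θ hθ, ?_⟩
  rw [DCE_eq θ hθ, Rbar_eq θ hθ0 hθ, Real.rpow_logb (by norm_num) (by norm_num) hθ0]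
end

section
/- Let R̄ ≥ (1 + log₂(2+√3))/2 and suppose θ₁, θ₂ > 0 satisfy R̃(θ₁) = R̄ and R̄(θ₂) = R̄ (so that the optimal scheme and the compress-and-estimate scheme operate at the same rate R̄ bits per sample). Then the normalized compress-and-estimate excess distortion satisfies (1/6 + D_CEint(θ₂)) − (1/6 + D̃(θ₁)) = ((2 − √3)/6)·2^{−2R̄}; equivalently, in unnormalized form, D_CE(f_s,R) − D(f_s,R) = (σ²/f_s)·((2 − √3)/6)·2^{−2R/f_s} whenever R/f_s ≥ (1 + log₂(√3+2))/2. -/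
open Real MeasureTheory

/-- Normalized waterfilling distortion of the interpolated process `W̃`. -/
noncomputable def Dtilde (θ : ℝ) : ℝ := ∫ φ in (0:ℝ)..1, min θ (S φ - 1 / 6)

/-- Waterfilling rate for the interpolated process `W̃`. -/
noncomputable def Rtilde (θ : ℝ) : ℝ :=
  (1 / 2) * ∫ φ in (0:ℝ)..1, max 0 (Real.logb 2 ((S φ - 1 / 6) / θ))

lemma wf_aux (f : ℝ → ℝ) (m c θ : ℝ) (hm : 0 < m) (hθ : 0 < θ)
    (hf : ∀ x ∈ Set.Ioo (0:ℝ) 1, m < f x)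
    (hi : IntervalIntegrable (fun x => Real.logb 2 (f x)) volume 0 1)
    (hc : ∫ x in (0:ℝ)..1, Real.logb 2 (f x) = c)
    (hW : (1 / 2) * (c - Real.logb 2 m) ≤
      (1 / 2) * ∫ x in (0:ℝ)..1, max 0 (Real.logb 2 (f x / θ))) :
    θ ≤ m ∧ (2:ℝ) ^ c * (2:ℝ) ^
      (-(2 * ((1 / 2) * ∫ x in (0:ℝ)..1, max 0 (Real.logb 2 (f x / θ))))) = θ := by
  have hle : θ ≤ m := by
    by_contra hlt
    push Not at hlt
    have hi2 : IntervalIntegrable (fun x => max 0 (Real.logb 2 (f x) - Real.logb 2 θ))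
        volume 0 1 := by
      have h0 : IntervalIntegrable (fun x => Real.logb 2 (f x) - Real.logb 2 θ) volume 0 1 :=
        hi.sub intervalIntegrable_const
      rw [intervalIntegrable_iff] at h0 ⊢
      exact (integrable_zero _ _ _).sup h0
    have hi1 : IntervalIntegrable (fun x => Real.logb 2 (f x) - Real.logb 2 m) volume 0 1 :=
      hi.sub intervalIntegrable_const
    have hpos := intervalIntegral.intervalIntegral_pos_of_pos_on (hi1.sub hi2) (fun x hx => by
      have h1 := hf x hx
      have h2 : Real.logb 2 m < Real.logb 2 (f x) := Real.logb_lt_logb (by norm_num) hm h1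
      have h3 : Real.logb 2 m < Real.logb 2 θ := Real.logb_lt_logb (by norm_num) hm hlt
      have : max 0 (Real.logb 2 (f x) - Real.logb 2 θ) < Real.logb 2 (f x) - Real.logb 2 m :=
        max_lt (by linarith) (by linarith)
      simpa using this) one_pos
    rw [intervalIntegral.integral_sub hi1 hi2,
      intervalIntegral.integral_sub hi intervalIntegrable_const, hc] at hpos
    have e : ∫ x in (0:ℝ)..1, max 0 (Real.logb 2 (f x / θ)) =
        ∫ x in (0:ℝ)..1, max 0 (Real.logb 2 (f x) - Real.logb 2 θ) := by
      apply intervalIntegral.integral_congr_Ioo_of_le zero_le_one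
      intro x hx
      have := hf x hx
      simp only
      rw [Real.logb_div (by linarith) hθ.ne']
    rw [e] at hW
    simp at hpos
    linarith
  refine ⟨hle, ?_⟩
  have e : ∫ x in (0:ℝ)..1, max 0 (Real.logb 2 (f x / θ)) = c - Real.logb 2 θ := by
    have : ∫ x in (0:ℝ)..1, max 0 (Real.logb 2 (f x / θ)) =
        ∫ x in (0:ℝ)..1, (Real.logb 2 (f x) - Real.logb 2 θ) := by
      apply intervalIntegral.integral_congr_Ioo_of_le zero_le_one
      intro x hx
      have := hf x hx
      have h2 : Real.logb 2 θ < Real.logb 2 (f x) :=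
        Real.logb_lt_logb (by norm_num) hθ (by linarith)
      simp only
      rw [Real.logb_div (by linarith) hθ.ne', max_eq_right (by linarith)]
    rw [this, intervalIntegral.integral_sub hi intervalIntegrable_const, hc]
    simp
  rw [e, ← Real.rpow_add (by norm_num)]
  have : c + -(2 * (1 / 2 * (c - Real.logb 2 θ))) = Real.logb 2 θ := by ring
  rw [this, Real.rpow_logb (by norm_num) (by norm_num) hθ]

lemma sin_bd (x : ℝ) (hx : x ∈ Set.Ioo (0:ℝ) 1) :
    0 < Real.sin (Real.pi * x / 2) ∧ Real.sin (Real.pi * x / 2) < 1 := by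
  have hp := Real.pi_pos
  have h0 : 0 < Real.pi * x := mul_pos hp hx.1
  have h1 : Real.pi * x < Real.pi := by nlinarith [hx.2]
  refine ⟨Real.sin_pos_of_pos_of_lt_pi (by linarith) (by linarith), ?_⟩
  have := Real.sin_lt_sin_of_lt_of_le_pi_div_two (x := Real.pi * x / 2) (y := Real.pi / 2)
    (by linarith) le_rfl (by linarith)
  simpa using this

lemma S_gt (x : ℝ) (hx : x ∈ Set.Ioo (0:ℝ) 1) : 1 / 4 < S x := by
  obtain ⟨h0, h1⟩ := sin_bd x hx
  unfold S
  apply one_div_lt_one_div_of_lt (by positivity)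
  nlinarith

lemma logsin_int : IntervalIntegrable (fun x => Real.log (Real.sin (Real.pi * x / 2))) volume 0 1 := by
  have h := (intervalIntegrable_log_sin (a := 0) (b := π / 2)).comp_mul_left (c := π / 2)
  have hp := Real.pi_pos.ne'
  have e : π / 2 / (π / 2) = 1 := by field_simp
  rw [zero_div, e] at h
  convert h using 2 with x
  simp only [Function.comp]
  congr 2
  ring

lemma logsin_val : ∫ x in (0:ℝ)..1, Real.log (Real.sin (Real.pi * x / 2)) = - Real.log 2 := by
  have h := intervalIntegral.integral_comp_mul_left (a := 0) (b := 1)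
    (fun x => Real.log (Real.sin x)) (c := π / 2) (by positivity)
  have hp := Real.pi_pos.ne'
  rw [mul_zero, mul_one, integral_log_sin_zero_pi_div_two] at h
  have e : ∀ x : ℝ, π * x / 2 = π / 2 * x := fun x => by ring
  simp only [e]
  rw [h, smul_eq_mul]
  field_simp

lemma logS_eq (x : ℝ) (hx : x ∈ Set.Ioo (0:ℝ) 1) :
    Real.logb 2 (S x) = (- Real.log 4 - 2 * Real.log (Real.sin (Real.pi * x / 2))) / Real.log 2 := by
  obtain ⟨h0, h1⟩ := sin_bd x hx
  unfold S Real.logb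
  rw [one_div, Real.log_inv, Real.log_mul (by norm_num) (by positivity), Real.log_pow]
  push_cast
  ring

lemma logS_int0 : IntervalIntegrable (fun x =>
    (- Real.log 4 - 2 * Real.log (Real.sin (Real.pi * x / 2))) / Real.log 2) volume 0 1 :=
  (intervalIntegrable_const.sub (logsin_int.const_mul 2)).div_const _

lemma logS_int : IntervalIntegrable (fun x => Real.logb 2 (S x)) volume 0 1 := by
  apply logS_int0.congr_uIoo
  rw [Set.uIoo_of_le zero_le_one]
  intro x hx
  exact (logS_eq x hx).symm

lemma log4 : Real.log 4 = 2 * Real.log 2 := by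
  rw [show (4:ℝ) = 2 ^ 2 by norm_num, Real.log_pow]; norm_num

lemma logS_val : ∫ x in (0:ℝ)..1, Real.logb 2 (S x) = 0 := by
  rw [intervalIntegral.integral_congr_Ioo_of_le zero_le_one logS_eq,
    intervalIntegral.integral_div,
    intervalIntegral.integral_sub intervalIntegrable_const (logsin_int.const_mul 2),
    intervalIntegral.integral_const_mul, logsin_val, log4]
  simp

lemma cos_pos' (t : ℝ) : 0 < 2 / 3 + 1 / 3 * Real.cos t := by
  linarith [Real.neg_one_le_cos t]

lemma cont_aux : Continuous (fun t : ℝ => Real.log (2 / 3 + 1 / 3 * Real.cos t)) := by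
  apply Continuous.log (by fun_prop)
  intro t
  exact (cos_pos' t).ne'

lemma circ : ∫ t in (0:ℝ)..(2 * π), Real.log (2 / 3 + 1 / 3 * Real.cos t)
    = 2 * π * Real.log ((2 + √3) / 6) := by
  have h3 : √3 ^ 2 = 3 := Real.sq_sqrt (by norm_num)
  have h30 : 0 ≤ √3 := Real.sqrt_nonneg 3
  have hlt : √3 < 2 := by nlinarith
  have hgt : 1 < √3 := by nlinarith
  have h := circleAverage_log_norm_sub_const₀ (a := ((√3 - 2 : ℝ) : ℂ))
    (by rw [Complex.norm_real, Real.norm_eq_abs, abs_lt]; constructor <;> linarith)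
  rw [Real.circleAverage_def, smul_eq_mul, mul_eq_zero] at h
  have h := h.resolve_left (by have := Real.pi_pos; positivity)
  have key : ∀ t : ℝ, Real.log ‖circleMap 0 1 t - ((√3 - 2 : ℝ) : ℂ)‖ =
      (Real.log (2 / 3 + 1 / 3 * Real.cos t) - Real.log ((2 + √3) / 6)) / 2 := by
    intro t
    rw [Complex.norm_def, Real.log_sqrt (Complex.normSq_nonneg _),
      ← Real.log_div (cos_pos' t).ne' (by positivity)]
    congr 2
    have : Complex.normSq (circleMap 0 1 t - ((√3 - 2 : ℝ) : ℂ)) =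
       (Real.cos t - (√3 - 2)) * (Real.cos t - (√3 - 2)) + Real.sin t * Real.sin t := by
      simp [circleMap, Complex.normSq_apply]
    rw [this, eq_div_iff (by positivity)]
    have hs := Real.sin_sq t
    have : Real.sin t * Real.sin t = 1 - Real.cos t ^ 2 := by rw [← hs]; ring
    rw [this]
    linear_combination (√3 / 6 - 1 / 3 - 1 / 3 * Real.cos t) * h3
  simp only [key] at h
  rw [intervalIntegral.integral_div, intervalIntegral.integral_sub
    (cont_aux.intervalIntegrable _ _) intervalIntegrable_const] at h
  simp at h
  linarith

lemma half : ∫ t in (0:ℝ)..π, Real.log (2 / 3 + 1 / 3 * Real.cos t)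
    = π * Real.log ((2 + √3) / 6) := by
  have h := circ
  rw [← intervalIntegral.integral_add_adjacent_intervals (b := π)
    (cont_aux.intervalIntegrable _ _) (cont_aux.intervalIntegrable _ _)] at h
  have h2 := intervalIntegral.integral_comp_sub_left (a := 0) (b := π)
    (fun t => Real.log (2 / 3 + 1 / 3 * Real.cos t)) (2 * π)
  simp only [Real.cos_two_pi_sub, sub_zero] at h2
  rw [show 2 * π - π = π by ring] at h2
  rw [← h2] at h
  linarith

lemma logcos_val : ∫ x in (0:ℝ)..1, Real.log (2 / 3 + 1 / 3 * Real.cos (π * x))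
    = Real.log ((2 + √3) / 6) := by
  have h := intervalIntegral.integral_comp_mul_left (a := 0) (b := 1)
    (fun t => Real.log (2 / 3 + 1 / 3 * Real.cos t)) (c := π) (by positivity)
  have hp := Real.pi_pos.ne'
  rw [mul_zero, mul_one, half] at h
  rw [h, smul_eq_mul]
  field_simp

lemma cos_eq (x : ℝ) : Real.cos (π * x) = 1 - 2 * Real.sin (π * x / 2) ^ 2 := by
  rw [show π * x = 2 * (π * x / 2) by ring, Real.cos_two_mul, Real.cos_sq']
  rw [show 2 * (π * x / 2) / 2 = π * x / 2 by ring]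
  ring

lemma logS6_eq (x : ℝ) (hx : x ∈ Set.Ioo (0:ℝ) 1) :
    Real.logb 2 (S x - 1 / 6) =
      Real.log (2 / 3 + 1 / 3 * Real.cos (π * x)) / Real.log 2 + Real.logb 2 (S x) := by
  have h4 := S_gt x hx
  obtain ⟨h0, h1⟩ := sin_bd x hx
  have : S x - 1 / 6 = (2 / 3 + 1 / 3 * Real.cos (π * x)) * S x := by
    rw [cos_eq]; unfold S; field_simp; ring
  rw [this, Real.logb_mul (cos_pos' _).ne' (by linarith)]
  rfl

lemma logcos_int : IntervalIntegrable
    (fun x => Real.log (2 / 3 + 1 / 3 * Real.cos (π * x)) / Real.log 2) volume 0 1 := by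
  apply Continuous.intervalIntegrable
  exact (cont_aux.comp (continuous_const.mul continuous_id)).div_const _

lemma logS6_int : IntervalIntegrable (fun x => Real.logb 2 (S x - 1 / 6)) volume 0 1 := by
  apply (logcos_int.add logS_int).congr_uIoo
  rw [Set.uIoo_of_le zero_le_one]
  intro x hx
  exact (logS6_eq x hx).symm

lemma logS6_val : ∫ x in (0:ℝ)..1, Real.logb 2 (S x - 1 / 6) = Real.logb 2 ((2 + √3) / 6) := by
  rw [intervalIntegral.integral_congr_Ioo_of_le zero_le_one logS6_eq,
    intervalIntegral.integral_add logcos_int logS_int, logS_val,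
    intervalIntegral.integral_div, logcos_val, add_zero]
  rfl

lemma cos_val : ∫ x in (0:ℝ)..1, (2 / 3 + 1 / 3 * Real.cos (π * x)) = 2 / 3 := by
  rw [intervalIntegral.integral_add intervalIntegrable_const
    (Continuous.intervalIntegrable (by fun_prop) _ _), intervalIntegral.integral_const_mul,
    intervalIntegral.integral_comp_mul_left (fun t => Real.cos t) Real.pi_pos.ne']
  simp

/-- When the optimal scheme and the compress-and-estimate scheme operate at the same
rate `R̄ ≥ (1 + log₂(2+√3))/2` bits per sample, the (normalized) excess distortion of
compress-and-estimate equals `((2−√3)/6)·2^{−2R̄}`; i.e., in unnormalized form,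
`D_CE(f_s,R) − D(f_s,R) = (σ²/f_s)((2−√3)/6)·2^{−2R/f_s}`. -/
theorem stmt9 (Rb θ₁ θ₂ : ℝ)
    (hR : (1 + Real.logb 2 (2 + Real.sqrt 3)) / 2 ≤ Rb)
    (hθ₁ : 0 < θ₁) (hθ₂ : 0 < θ₂)
    (h1 : Rtilde θ₁ = Rb) (h2 : Rbar θ₂ = Rb) :
    (1 / 6 + DCEint θ₂) - (1 / 6 + Dtilde θ₁)
      = ((2 - Real.sqrt 3) / 6) * (2 : ℝ) ^ (-(2 * Rb)) := by
  unfold Rtilde at h1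
  unfold Rbar at h2
  have l2 : Real.logb 2 2 = 1 := Real.logb_self_eq_one (by norm_num)
  have h3p : 0 < 2 + √3 := by positivity
  have hA := wf_aux (fun x => S x - 1 / 6) (1 / 12) _ θ₁ (by norm_num) hθ₁
    (fun x hx => by linarith [S_gt x hx]) logS6_int logS6_val (by
      rw [h1, ← Real.logb_div (by positivity) (by norm_num),
        show (2 + √3) / 6 / (1 / 12) = 2 * (2 + √3) by ring,
        Real.logb_mul (by norm_num) h3p.ne', l2]
      linarith)
  have hB := wf_aux S (1 / 4) _ θ₂ (by norm_num) hθ₂ S_gt logS_int logS_val (by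
      rw [h2]
      have e : Real.logb 2 (1 / 4) = -2 := by
        rw [show (1 / 4 : ℝ) = 2 ^ (-2 : ℝ) by norm_num [Real.rpow_neg],
          Real.logb_rpow (by norm_num) (by norm_num)]
      have : Real.logb 2 2 ≤ Real.logb 2 (2 + √3) :=
        Real.logb_le_logb_of_le (by norm_num) (by norm_num) (by linarith [Real.sqrt_nonneg 3])
      rw [e]
      linarith)
  simp only [h1] at hA
  rw [h2] at hB
  obtain ⟨hA1, hA2⟩ := hA
  obtain ⟨hB1, hB2⟩ := hB
  rw [Real.rpow_logb (by norm_num) (by norm_num) (by positivity)] at hA2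
  rw [Real.rpow_zero, one_mul] at hB2
  have hD : Dtilde θ₁ = θ₁ := by
    unfold Dtilde
    rw [intervalIntegral.integral_congr_Ioo_of_le (g := fun _ => θ₁) zero_le_one
      (fun x hx => min_eq_left (by linarith [S_gt x hx]))]
    simp
  have hE : DCEint θ₂ = θ₂ * (2 / 3) := by
    unfold DCEint
    rw [intervalIntegral.integral_congr_Ioo_of_le
      (g := fun x => θ₂ * (2 / 3 + 1 / 3 * Real.cos (π * x))) zero_le_one
      (fun x hx => by
        have h4 := S_gt x hx
        obtain ⟨h0, h1⟩ := sin_bd x hx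
        simp only
        rw [min_eq_left (by linarith), cos_eq]
        unfold S
        field_simp
        ring), intervalIntegral.integral_const_mul, cos_val]
  rw [hD, hE, ← hA2, ← hB2]
  ring
end

section
/- As θ → ∞, the quantity (1/R̃(θ))·( 1/6 + D̃(θ) − 2/(π²·ln 2 · R̃(θ)) ) converges to (ln 2)/18. (Equivalently, in the high-sampling-rate regime the indirect distortion-rate function of the Wiener process given its rate-f_s uniform samples satisfies D(f_s,R) = 2σ²/(π²·ln 2)·R⁻¹ + (σ²·ln 2/18)·R/f_s² + o(f_s⁻²), so it converges to the distortion-rate function D_W(R) of the Wiener process at rate inversely quadratic in f_s.) -/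
open Real Filter MeasureTheory

noncomputable def ww (x : ℝ) : ℝ := 1 / Real.sinc x ^ 2 - 2 * x ^ 2 / 3

lemma sinc_pos' {x : ℝ} (h0 : 0 ≤ x) (h1 : x ≤ 1) : 0 < Real.sinc x := by
  rcases h0.eq_or_lt with h | h
  · subst h; simp
  · rw [Real.sinc_of_ne_zero h.ne']
    exact div_pos (Real.sin_pos_of_pos_of_lt_pi h (by linarith [Real.pi_gt_three])) h

lemma ww_pos {x : ℝ} (h0 : 0 ≤ x) (h1 : x ≤ 1) : 0 < ww x := by
  have hs := sinc_pos' h0 h1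
  have : 1 ≤ 1 / Real.sinc x ^ 2 := by
    rw [le_div_iff₀ (by positivity)]
    nlinarith [Real.sinc_le_one x]
  unfold ww
  nlinarith

lemma hcont : ContinuousOn (fun x => Real.log (ww x)) (Set.Icc 0 1) := by
  apply ContinuousOn.log
  · unfold ww
    apply ContinuousOn.sub
    · apply ContinuousOn.div continuousOn_const
      · exact (Real.continuous_sinc.pow 2).continuousOn
      · intro x hx
        have := sinc_pos' hx.1 hx.2
        positivity
    · fun_prop
  · intro x hx
    exact (ww_pos hx.1 hx.2).ne'

lemma g_eq {x : ℝ} (h0 : 0 < x) :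
    1 / (4 * Real.sin x ^ 2) - 1 / 6 = ww x / (4 * x ^ 2) := by
  unfold ww
  rw [Real.sinc_of_ne_zero h0.ne']
  by_cases h : Real.sin x = 0
  · simp [h]; field_simp; norm_num
  · field_simp; ring

noncomputable def th (y : ℝ) : ℝ := 1 / (4 * Real.sin y ^ 2) - 1 / 6

lemma th_anti {x y : ℝ} (h0 : 0 < x) (hxy : x ≤ y) (hy : y ≤ π / 2) : th y ≤ th x := by
  unfold th
  have h1 : 0 < Real.sin x := Real.sin_pos_of_pos_of_lt_pi h0 (by linarith [Real.pi_pos])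
  have h2 : Real.sin x ≤ Real.sin y :=
    Real.sin_le_sin_of_le_of_le_pi_div_two (by linarith [Real.pi_pos]) hy hxy
  gcongr

lemma th_pos {x : ℝ} (h0 : 0 < x) (hy : x ≤ π / 2) : 0 < th x := by
  have := th_anti h0 hy le_rfl
  have h : th (π / 2) = 1 / 12 := by unfold th; simp; norm_num
  linarith

lemma R_formula {y : ℝ} (h0 : 0 < y) (h1 : y ≤ 1) :
    Rtilde (th y) = (1 / (π * Real.log 2)) *
      (2 * y + (∫ x in (0:ℝ)..y, Real.log (ww x)) - y * Real.log (ww y)) := by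
  have hpi := Real.pi_gt_three
  have hl2 : 0 < Real.log 2 := Real.log_pos (by norm_num)
  have hty := th_pos h0 (by linarith)
  set F : ℝ → ℝ := fun x => max 0 (Real.logb 2 (th x / th y)) with hF
  have e1 : Rtilde (th y) = (1/2) * ∫ φ in (0:ℝ)..1, F (π / 2 * φ) := by
    unfold Rtilde
    congr 1
    apply intervalIntegral.integral_congr
    intro φ _
    simp only [hF, S]
    rw [show π * φ / 2 = π / 2 * φ by ring]
    rfl
  rw [e1, intervalIntegral.integral_comp_mul_left F (by positivity)]
  set G : ℝ → ℝ := fun x => (1 / Real.log 2) *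
    ((2 * Real.log y - Real.log (ww y)) - 2 * Real.log x + Real.log (ww x)) with hG
  have hih : IntervalIntegrable (fun x => Real.log (ww x)) volume 0 y := by
    apply ContinuousOn.intervalIntegrable
    rw [Set.uIcc_of_le h0.le]
    exact hcont.mono (Set.Icc_subset_Icc le_rfl h1)
  have hil : IntervalIntegrable (fun x => 2 * Real.log x) volume 0 y :=
    intervalIntegral.intervalIntegrable_log'.const_mul 2
  have hGi : IntervalIntegrable G volume 0 y :=
    ((intervalIntegrable_const.sub hil).add hih).const_mul _
  have hFG : Set.EqOn F G (Set.uIoc 0 y) := by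
    rw [Set.uIoc_of_le h0.le]
    intro x hx
    have hr : 1 ≤ th x / th y := by
      rw [le_div_iff₀ hty, one_mul]
      exact th_anti hx.1 hx.2 (by linarith)
    simp only [hF, hG]
    rw [max_eq_right (Real.logb_nonneg (by norm_num) hr), Real.logb]
    have hwx := ww_pos hx.1.le (hx.2.trans h1)
    have hwy := ww_pos h0.le h1
    have hx0 := hx.1
    unfold th
    rw [g_eq hx0, g_eq h0, Real.log_div (by positivity) (by positivity),
      Real.log_div (by positivity) (by positivity), Real.log_div (by positivity) (by positivity),
      Real.log_mul (by positivity) (by positivity), Real.log_mul (by positivity) (by positivity),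
      Real.log_pow, Real.log_pow]
    push_cast
    ring
  have hF0 : Set.EqOn F (fun _ => 0) (Set.uIoc y (π / 2)) := by
    rw [Set.uIoc_of_le (by linarith)]
    intro x hx
    have hx0 : 0 < x := h0.trans hx.1
    simp only [hF]
    apply max_eq_left
    have := th_pos hx0 hx.2
    apply Real.logb_nonpos (by norm_num) (by positivity)
    rw [div_le_one hty]
    exact th_anti h0 hx.1.le hx.2
  have i1 : IntervalIntegrable F volume 0 y := hGi.congr hFG.symm
  have i2 : IntervalIntegrable F volume y (π/2) :=
    (intervalIntegrable_const (c := (0:ℝ))).congr hF0.symm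
  rw [mul_zero, mul_one, ← intervalIntegral.integral_add_adjacent_intervals i1 i2]
  rw [intervalIntegral.integral_congr_ae (Eventually.of_forall (fun x hx => hFG hx)),
    intervalIntegral.integral_congr_ae (Eventually.of_forall (fun x hx => hF0 hx))]
  simp only [hG]
  rw [intervalIntegral.integral_const_mul, intervalIntegral.integral_add
    (intervalIntegrable_const.sub hil) hih, intervalIntegral.integral_sub
    intervalIntegrable_const hil, intervalIntegral.integral_const_mul, integral_log]
  simp
  field_simp
  ring

lemma D_formula {y : ℝ} (h0 : 0 < y) (h1 : y ≤ 1) :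
    1 / 6 + Dtilde (th y) = (1 / (2 * π)) *
      (y / Real.sin y ^ 2 + Real.cos y / Real.sin y) := by
  have hpi := Real.pi_gt_three
  set F : ℝ → ℝ := fun x => min (th y) (th x) with hF
  have e1 : Dtilde (th y) = ∫ φ in (0:ℝ)..1, F (π / 2 * φ) := by
    unfold Dtilde
    apply intervalIntegral.integral_congr
    intro φ _
    simp only [hF, S]
    rw [show π * φ / 2 = π / 2 * φ by ring]
    rfl
  rw [e1, intervalIntegral.integral_comp_mul_left F (by positivity)]
  have hFG : Set.EqOn F (fun _ => th y) (Set.uIoc 0 y) := by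
    rw [Set.uIoc_of_le h0.le]
    intro x hx
    exact min_eq_left (th_anti hx.1 hx.2 (by linarith))
  have hF0 : Set.EqOn F th (Set.uIoc y (π / 2)) := by
    rw [Set.uIoc_of_le (by linarith)]
    intro x hx
    exact min_eq_right (th_anti h0 hx.1.le hx.2)
  have hsin : ∀ x ∈ Set.uIcc y (π / 2), 0 < Real.sin x := by
    rw [Set.uIcc_of_le (by linarith)]
    intro x hx
    exact Real.sin_pos_of_pos_of_lt_pi (by linarith [hx.1]) (by linarith [hx.2])
  have hthi : IntervalIntegrable th volume y (π / 2) := by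
    apply ContinuousOn.intervalIntegrable
    unfold th
    apply ContinuousOn.sub _ continuousOn_const
    apply ContinuousOn.div continuousOn_const (by fun_prop)
    intro x hx
    have := hsin x hx
    positivity
  have i1 : IntervalIntegrable F volume 0 y := intervalIntegrable_const.congr hFG.symm
  have i2 : IntervalIntegrable F volume y (π/2) := hthi.congr hF0.symm
  rw [mul_zero, mul_one, ← intervalIntegral.integral_add_adjacent_intervals i1 i2]
  rw [intervalIntegral.integral_congr_ae (Eventually.of_forall (fun x hx => hFG hx)),
    intervalIntegral.integral_congr_ae (Eventually.of_forall (fun x hx => hF0 hx))]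
  rw [intervalIntegral.integral_eq_sub_of_hasDerivAt
    (f := fun x => - (1/4) * (Real.cos x / Real.sin x) - x / 6) _ hthi]
  · have := hsin y Set.left_mem_uIcc
    simp [th]
    field_simp
    ring
  · intro x hx
    have hs := hsin x hx
    have := (((Real.hasDerivAt_cos x).div (Real.hasDerivAt_sin x) hs.ne').const_mul
      (-(1/4:ℝ))).sub ((hasDerivAt_id x).div_const 6)
    refine this.congr_deriv ?_
    unfold th
    have h2 := Real.sin_sq_add_cos_sq x
    have h3 : Real.cos x ^ 2 = 1 - Real.sin x ^ 2 := by linarith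
    field_simp
    rw [h3]
    ring

lemma lim_p : Tendsto (fun x : ℝ => (1 - Real.sinc x) / x ^ 2) (nhdsWithin 0 (Set.Ioi 0))
    (nhds (1 / 6)) := by
  have hid : Tendsto (fun x : ℝ => x) (nhdsWithin 0 (Set.Ioi 0)) (nhds 0) :=
    tendsto_nhdsWithin_of_tendsto_nhds tendsto_id
  rw [tendsto_iff_norm_sub_tendsto_zero]
  apply squeeze_zero' (Eventually.of_forall fun _ => norm_nonneg _) _
    (by simpa using (hid.pow 2).mul_const (1/100))
  filter_upwards [Ioo_mem_nhdsGT (show (0:ℝ) < 1 by norm_num)] with x hx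
  have h := Real.sin_bound (x := x) (by rw [abs_of_pos hx.1]; exact hx.2.le)
  have hx0 := hx.1
  rw [abs_of_pos hx0] at h
  rw [Real.sinc_of_ne_zero hx0.ne', Real.norm_eq_abs]
  have e : (1 - Real.sin x / x) / x ^ 2 - 1 / 6 = - (Real.sin x - (x - x ^ 3 / 6)) / x ^ 3 := by
    field_simp; ring
  rw [e, abs_div, abs_neg, abs_of_pos (pow_pos hx0 3), div_le_iff₀ (by positivity)]
  calc _ ≤ _ := h
    _ = _ := by ring

lemma lim_q : Tendsto (fun x : ℝ => (1 - Real.cos x) / x ^ 2) (nhdsWithin 0 (Set.Ioi 0))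
    (nhds (1 / 2)) := by
  have hid : Tendsto (fun x : ℝ => x) (nhdsWithin 0 (Set.Ioi 0)) (nhds 0) :=
    tendsto_nhdsWithin_of_tendsto_nhds tendsto_id
  rw [tendsto_iff_norm_sub_tendsto_zero]
  apply squeeze_zero' (Eventually.of_forall fun _ => norm_nonneg _) _
    (by simpa using (hid.pow 2).mul_const (5/96))
  filter_upwards [Ioo_mem_nhdsGT (show (0:ℝ) < 1 by norm_num)] with x hx
  have h := Real.cos_bound (x := x) (by rw [abs_of_pos hx.1]; exact hx.2.le)
  have hx0 := hx.1
  rw [abs_of_pos hx0] at h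
  rw [Real.norm_eq_abs]
  have e : (1 - Real.cos x) / x ^ 2 - 1 / 2 = - (Real.cos x - (1 - x ^ 2 / 2)) / x ^ 2 := by
    field_simp; ring
  rw [e, abs_div, abs_neg, abs_of_pos (pow_pos hx0 2), div_le_iff₀ (by positivity)]
  calc _ ≤ _ := h
    _ = _ := by ring

lemma lim_s : Tendsto Real.sinc (nhdsWithin 0 (Set.Ioi 0)) (nhds 1) := by
  have := Real.continuous_sinc.tendsto 0
  rw [Real.sinc_zero] at this
  exact tendsto_nhdsWithin_of_tendsto_nhds this

lemma lim_id : Tendsto (fun x : ℝ => x) (nhdsWithin 0 (Set.Ioi 0)) (nhds 0) :=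
  tendsto_nhdsWithin_of_tendsto_nhds tendsto_id

lemma lim_d : Tendsto (fun y : ℝ => (y / Real.sin y ^ 2 + Real.cos y / Real.sin y - 2 / y) / y)
    (nhdsWithin 0 (Set.Ioi 0)) (nhds 0) := by
  have h : Tendsto (fun y : ℝ => (1 / Real.sinc y ^ 2) *
      ((3 * ((1 - Real.sinc y) / y ^ 2) - (1 - Real.cos y) / y ^ 2) +
      (((1 - Real.sinc y) / y ^ 2) * ((1 - Real.cos y) / y ^ 2) -
        2 * ((1 - Real.sinc y) / y ^ 2) ^ 2) * y ^ 2))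
      (nhdsWithin 0 (Set.Ioi 0))
      (nhds ((1 / 1 ^ 2) * ((3 * (1/6) - 1/2) + ((1/6) * (1/2) - 2 * (1/6)^2) * 0 ^ 2))) := by
    refine Tendsto.mul (Tendsto.div tendsto_const_nhds (lim_s.pow 2) (by norm_num)) ?_
    exact ((lim_p.const_mul 3).sub lim_q).add
      (((lim_p.mul lim_q).sub ((lim_p.pow 2).const_mul 2)).mul (lim_id.pow 2))
  norm_num at h
  refine h.congr' ?_
  filter_upwards [Ioo_mem_nhdsGT (show (0:ℝ) < 1 by norm_num)] with x hx
  have hx0 := hx.1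
  have hs : 0 < Real.sin x :=
    Real.sin_pos_of_pos_of_lt_pi hx0 (by linarith [Real.pi_gt_three, hx.2])
  rw [Real.sinc_of_ne_zero hx0.ne']
  field_simp
  ring

lemma lim_w : Tendsto (fun x : ℝ => (ww x - 1) / x ^ 2) (nhdsWithin 0 (Set.Ioi 0))
    (nhds (-(1 / 3))) := by
  have h : Tendsto (fun x : ℝ => ((1 - Real.sinc x) / x ^ 2) * (1 + Real.sinc x) / Real.sinc x ^ 2
      - 2 / 3) (nhdsWithin 0 (Set.Ioi 0)) (nhds ((1 / 6) * (1 + 1) / 1 ^ 2 - 2 / 3)) :=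
    ((lim_p.mul (lim_s.const_add 1)).div (lim_s.pow 2) (by norm_num)).sub_const _
  norm_num at h
  norm_num
  refine h.congr' ?_
  filter_upwards [Ioo_mem_nhdsGT (show (0:ℝ) < 1 by norm_num)] with x hx
  have hx0 := hx.1
  have hs := sinc_pos' hx0.le hx.2.le
  unfold ww
  field_simp
  ring

lemma lim_h : Tendsto (fun x : ℝ => Real.log (ww x) / x ^ 2) (nhdsWithin 0 (Set.Ioi 0))
    (nhds (-(1 / 3))) := by
  have hw : Tendsto ww (nhdsWithin 0 (Set.Ioi 0)) (nhds 1) := by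
    have : Tendsto (fun x => 1 / Real.sinc x ^ 2 - 2 * x ^ 2 / 3) (nhdsWithin 0 (Set.Ioi 0))
      (nhds (1 / 1 ^ 2 - 2 * 0 ^ 2 / 3)) :=
      (Tendsto.div tendsto_const_nhds (lim_s.pow 2) (by norm_num)).sub
        (((lim_id.pow 2).const_mul 2).div_const 3)
    norm_num at this
    refine this.congr fun x => ?_
    simp [ww]
  have hl := lim_w.div hw (by norm_num)
  rw [div_one] at hl
  refine tendsto_of_tendsto_of_tendsto_of_le_of_le' hl lim_w ?_ ?_
  · filter_upwards [Ioo_mem_nhdsGT (show (0:ℝ) < 1 by norm_num)] with x hx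
    have hx0 := hx.1
    have hp := ww_pos hx0.le hx.2.le
    have := Real.one_sub_inv_le_log_of_pos hp
    simp only [Pi.div_apply]
    rw [show (ww x - 1) / x ^ 2 / ww x = (1 - (ww x)⁻¹) / x ^ 2 by field_simp]
    gcongr
  · filter_upwards [Ioo_mem_nhdsGT (show (0:ℝ) < 1 by norm_num)] with x hx
    have hx0 := hx.1
    have hp := ww_pos hx0.le hx.2.le
    have := Real.log_le_sub_one_of_pos hp
    gcongr

lemma lim_int : Tendsto (fun y : ℝ => (∫ x in (0:ℝ)..y, Real.log (ww x)) / y ^ 3)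
    (nhdsWithin 0 (Set.Ioi 0)) (nhds (-(1 / 9))) := by
  rw [Metric.tendsto_nhds]
  intro ε hε
  have h := (Metric.tendsto_nhds.1 lim_h) (ε / 2) (by positivity)
  obtain ⟨δ, hδ, hsub⟩ := (mem_nhdsGT_iff_exists_Ioo_subset).1 h
  have hδ' : (0:ℝ) < δ := hδ
  filter_upwards [Ioo_mem_nhdsGT (show (0:ℝ) < min 1 δ by positivity)] with y hy
  have h0 := hy.1
  have h1 : y < 1 := hy.2.trans_le (min_le_left _ _)
  have h2 : y < δ := hy.2.trans_le (min_le_right _ _)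
  have hih : IntervalIntegrable (fun x => Real.log (ww x)) volume 0 y := by
    apply ContinuousOn.intervalIntegrable
    rw [Set.uIcc_of_le h0.le]
    exact hcont.mono (Set.Icc_subset_Icc le_rfl h1.le)
  have hb : ‖∫ x in (0:ℝ)..y, (Real.log (ww x) + x ^ 2 / 3)‖ ≤ (ε / 2 * y ^ 2) * |y - 0| := by
    apply intervalIntegral.norm_integral_le_of_norm_le_const
    rw [Set.uIoc_of_le h0.le]
    intro x hx
    have hx0 := hx.1
    have := hsub ⟨hx0, hx.2.trans_lt h2⟩
    simp only [Set.mem_ofPred_eq, Real.dist_eq] at this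
    rw [show Real.log (ww x) / x ^ 2 - -(1/3) = (Real.log (ww x) + x ^ 2 / 3) / x ^ 2 by
      field_simp; ring, abs_div, abs_of_pos (pow_pos hx0 2), div_lt_iff₀ (by positivity)] at this
    rw [Real.norm_eq_abs]
    refine this.le.trans ?_
    have := hx.2
    gcongr
  rw [intervalIntegral.integral_add hih (Continuous.intervalIntegrable (by fun_prop) _ _)] at hb
  simp only [intervalIntegral.integral_div, integral_pow] at hb
  norm_num at hb
  rw [abs_of_pos h0] at hb
  rw [Real.dist_eq]
  rw [show (∫ x in (0:ℝ)..y, Real.log (ww x)) / y ^ 3 - -(1/9) =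
    ((∫ x in (0:ℝ)..y, Real.log (ww x)) + y ^ 3 / 3 / 3) / y ^ 3 by field_simp; ring,
    abs_div, abs_of_pos (pow_pos h0 3), div_lt_iff₀ (by positivity)]
  refine hb.trans_lt ?_
  have : 0 < ε * y ^ 3 := by positivity
  nlinarith

lemma lim_main : Tendsto (fun y : ℝ =>
        (1 / Rtilde (th y)) *
          (1 / 6 + Dtilde (th y) - 2 / (Real.pi ^ 2 * Real.log 2 * Rtilde (th y))))
      (nhdsWithin 0 (Set.Ioi 0)) (nhds (Real.log 2 / 18)) := by
  set r : ℝ → ℝ := fun y => (∫ x in (0:ℝ)..y, Real.log (ww x)) / y ^ 3 - Real.log (ww y) / y ^ 2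
    with hr
  have lr : Tendsto r (nhdsWithin 0 (Set.Ioi 0)) (nhds (-(1/9) - -(1/3))) := lim_int.sub lim_h
  have lJ : Tendsto (fun y => 2 + r y * y ^ 2) (nhdsWithin 0 (Set.Ioi 0))
      (nhds (2 + (-(1/9) - -(1/3)) * 0 ^ 2)) := (lr.mul (lim_id.pow 2)).const_add 2
  have hlim := ((tendsto_const_nhds (x := Real.log 2)).div lJ (by norm_num)).mul
    ((lr.div lJ (by norm_num)).add (lim_d.div_const 2))
  have hJpos : ∀ᶠ y in nhdsWithin 0 (Set.Ioi 0), 0 < 2 + r y * y ^ 2 :=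
    lJ.eventually_const_lt (by norm_num)
  rw [show Real.log 2 / (2 + (-(1/9) - -(1/3)) * 0 ^ 2) * ((-(1/9) - -(1/3)) /
    (2 + (-(1/9) - -(1/3)) * 0 ^ 2) + 0 / 2) = Real.log 2 / 18 by ring] at hlim
  refine hlim.congr' ?_
  filter_upwards [Ioo_mem_nhdsGT (show (0:ℝ) < 1 by norm_num), hJpos] with y hy hJ
  have hy0 := hy.1
  have hpi := Real.pi_pos
  have hl2 : 0 < Real.log 2 := Real.log_pos (by norm_num)
  rw [R_formula hy0 hy.2.le, D_formula hy0 hy.2.le]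
  have e1 : 2 * y + (∫ x in (0:ℝ)..y, Real.log (ww x)) - y * Real.log (ww y)
    = y * (2 + r y * y ^ 2) := by
    simp only [hr]; field_simp; ring
  rw [e1]
  simp only [Pi.div_apply]
  obtain ⟨d, hd⟩ : ∃ d, d = (y / Real.sin y ^ 2 + Real.cos y / Real.sin y - 2 / y) / y := ⟨_, rfl⟩
  have e2 : y / Real.sin y ^ 2 + Real.cos y / Real.sin y = 2 / y + y * d := by
    rw [hd]; field_simp; ring
  rw [e2, show (2 / y + y * d - 2 / y) / y = d by field_simp; ring]
  generalize hJJ : 2 + r y * y ^ 2 = J at *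
  have e3 : r y = (J - 2) / y ^ 2 := by rw [← hJJ]; field_simp; ring
  rw [e3]
  field_simp
  ring

theorem stmt10 :
    Tendsto (fun θ : ℝ =>
        (1 / Rtilde θ) *
          (1 / 6 + Dtilde θ - 2 / (Real.pi ^ 2 * Real.log 2 * Rtilde θ)))
      atTop (nhds (Real.log 2 / 18)) := by
  have l1 : Tendsto (fun θ : ℝ => 1 / (2 * Real.sqrt (θ + 1 / 6))) atTop (nhds 0) := by
    refine Tendsto.const_div_atTop ?_ 1
    exact (Real.tendsto_sqrt_atTop.comp (tendsto_atTop_add_const_right _ _ tendsto_id)).const_mul_atTop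
      (by norm_num)
  have l2 : Tendsto (fun θ : ℝ => Real.arcsin (1 / (2 * Real.sqrt (θ + 1 / 6)))) atTop
      (nhdsWithin 0 (Set.Ioi 0)) := by
    rw [tendsto_nhdsWithin_iff]
    constructor
    · have := (Real.continuous_arcsin.tendsto 0).comp l1
      rwa [Real.arcsin_zero] at this
    · filter_upwards [eventually_gt_atTop 0] with θ hθ
      exact Real.arcsin_pos.2 (by positivity)
  refine (lim_main.comp l2).congr' ?_
  filter_upwards [eventually_gt_atTop 0, l1.eventually_lt_const (show (0:ℝ) < 1 by norm_num)]
    with θ hθ h1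
  have : th (Real.arcsin (1 / (2 * Real.sqrt (θ + 1 / 6)))) = θ := by
    unfold th
    have hp : 0 < 1 / (2 * Real.sqrt (θ + 1 / 6)) := by positivity
    rw [Real.sin_arcsin (by linarith) h1.le, div_pow, mul_pow, Real.sq_sqrt (by positivity)]
    field_simp
    ring
  simp only [Function.comp_apply, this]
end

section
/- For integers N ≥ 2 and 1 ≤ k ≤ N, let λ_k^{(N)} := 1/(4·sin²((2k−1)·π/(2·(2N+1)))) and let u_{k,n} := sin((2k−1)·π·n/(2N+1)) / sqrt( Σ_{m=1}^N sin²((2k−1)·π·m/(2N+1)) ) for n = 1,…,N (the normalized eigenvectors of the matrix (min(n,m))_{n,m=1}^N). Then for every θ > 0, the limit lim_{N→∞} (1/N) · Σ_{n=1}^{N−1} Σ_{k=1}^{N} u_{k,n}·u_{k,n+1}·min{λ_k^{(N)}, θ} exists and equals ∫₀¹ min{S(φ), θ}·cos(πφ) dφ, which in turn equals ∫₀¹ min{S(φ), θ} dφ − (1/2)·∫₀¹ (min{S(φ), θ}/S(φ)) dφ. -/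
open Real Filter MeasureTheory

lemma aux_sq (a : ℝ) (N : ℕ) :
    4 * Real.sin a * ∑ m ∈ Finset.Icc 1 N, Real.sin (a * (m : ℝ)) ^ 2
      = (2 * (N : ℝ) + 1) * Real.sin a - Real.sin ((2 * (N : ℝ) + 1) * a) := by
  induction N with
  | zero => simp
  | succ M ih =>
    rw [Finset.sum_Icc_succ_top (by omega), mul_add, ih]
    push_cast
    have h1 : (2 * ((M : ℝ) + 1) + 1) * a = 2 * (a * ((M : ℝ) + 1)) + a := by ring
    have h2 : (2 * (M : ℝ) + 1) * a = 2 * (a * ((M : ℝ) + 1)) - a := by ring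
    rw [h1, h2, Real.sin_add, Real.sin_sub, Real.cos_two_mul]
    have := Real.sin_sq_add_cos_sq (a * ((M : ℝ) + 1))
    linear_combination (4 * Real.sin a) * this

lemma aux_corr (a : ℝ) (M : ℕ) :
    4 * Real.sin a * ∑ n ∈ Finset.Icc 1 M, Real.sin (a * (n : ℝ)) * Real.sin (a * ((n : ℝ) + 1))
      = 2 * ((M : ℝ) + 1) * Real.cos a * Real.sin a - Real.sin (2 * ((M : ℝ) + 1) * a) := by
  induction M with
  | zero => simp [Real.sin_two_mul]; ring
  | succ M ih =>
    rw [Finset.sum_Icc_succ_top (by omega), mul_add, ih]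
    push_cast
    have h1 : 2 * ((M : ℝ) + 1 + 1) * a = 2 * (a * ((M : ℝ) + 1)) + 2 * a := by ring
    have h2 : 2 * ((M : ℝ) + 1) * a = 2 * (a * ((M : ℝ) + 1)) := by ring
    have h3 : a * ((M : ℝ) + 1 + 1) = a * ((M : ℝ) + 1) + a := by ring
    rw [h1, h2, h3, Real.sin_add, Real.sin_add, Real.sin_two_mul, Real.cos_two_mul,
      Real.sin_two_mul, Real.cos_two_mul]
    have e1 := Real.sin_sq_add_cos_sq (a * ((M : ℝ) + 1))
    have e2 := Real.sin_sq_add_cos_sq a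
    generalize Real.sin (a * ((M : ℝ) + 1)) = s at *
    generalize Real.cos (a * ((M : ℝ) + 1)) = c at *
    generalize Real.sin a = x at *
    generalize Real.cos a = y at *
    linear_combination (4 * x * y) * e1 + 4 * s * c * e2

lemma aux_riemann (G : ℝ → ℝ) (hG : Continuous G) :
    Tendsto (fun N : ℕ => (2 / (2 * (N : ℝ) + 1)) *
      ∑ k ∈ Finset.Icc 1 N, G ((2 * (k : ℝ) - 1) / (2 * (N : ℝ) + 1)))
      atTop (nhds (∫ x in (0:ℝ)..1, G x)) := by
  have hδ : Tendsto (fun N : ℕ => 1 / (2 * (N : ℝ) + 1)) atTop (nhds 0) := by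
    simp only [one_div]
    apply tendsto_inv_atTop_zero.comp
    apply tendsto_atTop_add_const_right
    exact tendsto_natCast_atTop_atTop.const_mul_atTop (by norm_num)
  have hprim : Continuous (fun b : ℝ => ∫ x in (0:ℝ)..b, G x) :=
    intervalIntegral.continuous_primitive (fun a b => hG.intervalIntegrable a b) 0
  have hI : Tendsto (fun N : ℕ => ∫ x in (0:ℝ)..(1 - 1 / (2 * (N : ℝ) + 1)), G x) atTop
      (nhds (∫ x in (0:ℝ)..1, G x)) := by
    have h1 : Tendsto (fun N : ℕ => 1 - 1 / (2 * (N : ℝ) + 1)) atTop (nhds 1) := by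
      simpa using hδ.const_sub 1
    exact (hprim.tendsto 1).comp h1
  have hdiff : Tendsto (fun N : ℕ => (2 / (2 * (N : ℝ) + 1)) *
      ∑ k ∈ Finset.Icc 1 N, G ((2 * (k : ℝ) - 1) / (2 * (N : ℝ) + 1))
      - ∫ x in (0:ℝ)..(1 - 1 / (2 * (N : ℝ) + 1)), G x) atTop (nhds 0) := by
    rw [Metric.tendsto_nhds]
    intro ε hε
    have huc := isCompact_Icc.uniformContinuousOn_of_continuous
      (hG.continuousOn (s := Set.Icc (0:ℝ) 1))
    rw [Metric.uniformContinuousOn_iff] at huc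
    obtain ⟨d, hd, huc⟩ := huc (ε / 2) (by positivity)
    filter_upwards [hδ.eventually (gt_mem_nhds hd)] with N hN
    have hp : (0:ℝ) < 2 * (N : ℝ) + 1 := by positivity
    have hint : ∫ x in (0:ℝ)..(1 - 1 / (2 * (N : ℝ) + 1)), G x
        = ∑ k ∈ Finset.range N, ∫ x in (2 * (k : ℝ) / (2 * (N : ℝ) + 1))..(2 * ((k + 1 : ℕ) : ℝ) / (2 * (N : ℝ) + 1)), G x := by
      rw [intervalIntegral.sum_integral_adjacent_intervals
        (a := fun k : ℕ => 2 * (k : ℝ) / (2 * (N : ℝ) + 1))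
        (fun k _ => hG.intervalIntegrable _ _)]
      congr 1
      · simp
      · field_simp; ring
    have hsum : (2 / (2 * (N : ℝ) + 1)) *
      ∑ k ∈ Finset.Icc 1 N, G ((2 * (k : ℝ) - 1) / (2 * (N : ℝ) + 1))
        = ∑ k ∈ Finset.range N, ∫ x in (2 * (k : ℝ) / (2 * (N : ℝ) + 1))..(2 * ((k + 1 : ℕ) : ℝ) / (2 * (N : ℝ) + 1)), G ((2 * (k : ℝ) + 1) / (2 * (N : ℝ) + 1)) := by
      have hset : Finset.Icc 1 N = Finset.Ico (0 + 1) (N + 1) := by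
        ext; simp
      rw [Finset.mul_sum, Finset.range_eq_Ico, hset,
        ← Finset.sum_Ico_add' (fun k : ℕ => (2 / (2 * (N : ℝ) + 1)) *
          G ((2 * (k : ℝ) - 1) / (2 * (N : ℝ) + 1))) 0 N 1]
      apply Finset.sum_congr rfl
      intro k _
      rw [intervalIntegral.integral_const, smul_eq_mul]
      push_cast
      congr 1
      · field_simp; ring
      · congr 2; ring
    rw [hint, hsum, ← Finset.sum_sub_distrib, Real.dist_eq, sub_zero]
    have hterm : ∀ k ∈ Finset.range N,
        |(∫ x in (2 * (k : ℝ) / (2 * (N : ℝ) + 1))..(2 * ((k + 1 : ℕ) : ℝ) / (2 * (N : ℝ) + 1)), G ((2 * (k : ℝ) + 1) / (2 * (N : ℝ) + 1)))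
        - ∫ x in (2 * (k : ℝ) / (2 * (N : ℝ) + 1))..(2 * ((k + 1 : ℕ) : ℝ) / (2 * (N : ℝ) + 1)), G x| ≤ ε / 2 * (2 / (2 * (N : ℝ) + 1)) := by
      intro k hk
      have hk' : (k : ℝ) + 1 ≤ N := by exact_mod_cast Finset.mem_range.mp hk
      have hk0 : (0:ℝ) ≤ k := by positivity
      rw [← intervalIntegral.integral_sub (by simp) (hG.intervalIntegrable _ _)]
      have hw : (2 * ((k + 1 : ℕ) : ℝ) / (2 * (N : ℝ) + 1)) - (2 * (k : ℝ) / (2 * (N : ℝ) + 1)) = 2 / (2 * (N : ℝ) + 1) := by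
        push_cast; field_simp; ring
      have := intervalIntegral.norm_integral_le_of_norm_le_const
        (a := 2 * (k : ℝ) / (2 * (N : ℝ) + 1)) (b := 2 * ((k + 1 : ℕ) : ℝ) / (2 * (N : ℝ) + 1))
        (C := ε / 2) (f := fun x => G ((2 * (k : ℝ) + 1) / (2 * (N : ℝ) + 1)) - G x) ?_
      · rwa [hw, abs_of_pos (by positivity : (0:ℝ) < 2 / (2 * (N : ℝ) + 1)), Real.norm_eq_abs] at this
      · intro x hx
        rw [Set.uIoc_of_le (by push_cast; gcongr; linarith)] at hx
        obtain ⟨hx1, hx2⟩ := hx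
        push_cast at hx2
        rw [div_lt_iff₀ hp] at hx1
        rw [le_div_iff₀ hp] at hx2
        refine (huc _ ⟨by positivity, ?_⟩ x ⟨?_, ?_⟩ ?_).le
        · rw [div_le_one hp]; linarith
        · by_contra! h
          nlinarith
        · by_contra! h
          nlinarith
        · refine lt_of_le_of_lt ?_ hN
          rw [Real.dist_eq, abs_le]
          constructor
          · rw [← sub_nonneg]
            have : (2 * (k : ℝ) + 1) / (2 * (N : ℝ) + 1) - x - -(1 / (2 * (N : ℝ) + 1)) = (2 * (k + 1) - x * (2 * (N : ℝ) + 1)) / (2 * (N : ℝ) + 1) := by field_simp; ring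
            rw [this]; apply div_nonneg _ hp.le; linarith
          · rw [← sub_nonneg]
            have : (1 / (2 * (N : ℝ) + 1)) - ((2 * (k : ℝ) + 1) / (2 * (N : ℝ) + 1) - x) = (x * (2 * (N : ℝ) + 1) - 2 * k) / (2 * (N : ℝ) + 1) := by field_simp; ring
            rw [this]; apply div_nonneg _ hp.le; linarith
    calc _ ≤ _ := Finset.abs_sum_le_sum_abs _ _
      _ ≤ _ := Finset.sum_le_sum hterm
      _ = ε / 2 * (2 * N / (2 * (N : ℝ) + 1)) := by simp; ring
      _ ≤ ε / 2 * 1 := by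
        gcongr
        rw [div_le_one hp]; linarith
      _ < ε := by linarith
  simpa using hdiff.add hI

/-- continuous version of the truncated density -/
noncomputable def cS (θ φ : ℝ) : ℝ := 1 / max (4 * Real.sin (Real.pi * φ / 2) ^ 2) (1 / θ)

lemma cS_cont (θ : ℝ) (hθ : 0 < θ) : Continuous (cS θ) := by
  unfold cS
  refine Continuous.div continuous_const (by fun_prop) ?_
  intro x
  have : 0 < max (4 * Real.sin (Real.pi * x / 2) ^ 2) (1 / θ) := lt_max_of_lt_right (by positivity)
  exact this.ne'

lemma cS_eq (θ : ℝ) (hθ : 0 < θ) (φ : ℝ) (h0 : 0 < φ) (h1 : φ ≤ 1) : min (S φ) θ = cS θ φ := by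
  have hs : 0 < Real.sin (Real.pi * φ / 2) := by
    apply Real.sin_pos_of_pos_of_lt_pi
    · positivity
    · nlinarith [Real.pi_pos]
  unfold S cS
  have ha : 0 < 4 * Real.sin (Real.pi * φ / 2) ^ 2 := by positivity
  generalize 4 * Real.sin (Real.pi * φ / 2) ^ 2 = a at *
  rcases le_total a (1 / θ) with h | h
  · rw [max_eq_right h, one_div_one_div, min_eq_right]
    rw [le_div_iff₀ ha]; rw [le_div_iff₀ hθ] at h; linarith
  · rw [max_eq_left h, min_eq_left]
    rw [div_le_iff₀ ha]; rw [div_le_iff₀ hθ] at h; linarith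

lemma aux_term (θ : ℝ) (hθ : 0 < θ) (N : ℕ) (hN : 1 ≤ N) (k : ℕ) (hk : k ∈ Finset.Icc 1 N) :
    ∑ n ∈ Finset.Icc 1 (N - 1),
          (Real.sin ((2 * (k : ℝ) - 1) * Real.pi * (n : ℝ) / (2 * (N : ℝ) + 1)) /
              Real.sqrt (∑ m ∈ Finset.Icc 1 N,
                Real.sin ((2 * (k : ℝ) - 1) * Real.pi * (m : ℝ) / (2 * (N : ℝ) + 1)) ^ 2)) *
          (Real.sin ((2 * (k : ℝ) - 1) * Real.pi * ((n : ℝ) + 1) / (2 * (N : ℝ) + 1)) /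
              Real.sqrt (∑ m ∈ Finset.Icc 1 N,
                Real.sin ((2 * (k : ℝ) - 1) * Real.pi * (m : ℝ) / (2 * (N : ℝ) + 1)) ^ 2)) *
          min (1 / (4 * Real.sin ((2 * (k : ℝ) - 1) * Real.pi / (2 * (2 * (N : ℝ) + 1))) ^ 2)) θ
    = (2 * N * Real.cos (Real.pi * ((2 * (k : ℝ) - 1) / (2 * (N : ℝ) + 1))) - 1) / (2 * (N : ℝ) + 1)
      * cS θ ((2 * (k : ℝ) - 1) / (2 * (N : ℝ) + 1)) := by
  obtain ⟨hk1, hk2⟩ := Finset.mem_Icc.mp hk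
  have hk1' : (1:ℝ) ≤ k := by exact_mod_cast hk1
  have hk2' : (k:ℝ) ≤ N := by exact_mod_cast hk2
  have hp : (0:ℝ) < 2 * (N : ℝ) + 1 := by positivity
  have hφ0 : 0 < (2 * (k : ℝ) - 1) / (2 * (N : ℝ) + 1) := div_pos (by linarith) hp
  have hφ1 : (2 * (k : ℝ) - 1) / (2 * (N : ℝ) + 1) < 1 := by rw [div_lt_one hp]; linarith
  rw [← cS_eq θ hθ _ hφ0 hφ1.le]
  have hS : 1 / (4 * Real.sin ((2 * (k : ℝ) - 1) * Real.pi / (2 * (2 * (N : ℝ) + 1))) ^ 2)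
      = S ((2 * (k : ℝ) - 1) / (2 * (N : ℝ) + 1)) := by
    unfold S; congr 4; field_simp
  rw [hS, ← Finset.sum_mul]
  congr 1
  obtain ⟨a, ha⟩ : ∃ a, a = Real.pi * ((2 * (k : ℝ) - 1) / (2 * (N : ℝ) + 1)) := ⟨_, rfl⟩
  have hx : ∀ x : ℝ, (2 * (k : ℝ) - 1) * Real.pi * x / (2 * (N : ℝ) + 1) = a * x := by
    intro x; rw [ha]; ring
  simp only [hx, ← ha]
  have hsin : 0 < Real.sin a := by
    apply Real.sin_pos_of_pos_of_lt_pi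
    · rw [ha]; positivity
    · rw [ha]; nlinarith [Real.pi_pos]
  have hNa : (2 * (N : ℝ) + 1) * a = (k : ℝ) * (2 * Real.pi) - Real.pi := by
    rw [ha]; field_simp
  have e1 := aux_sq a N
  have e2 := aux_corr a (N - 1)
  have hN1 : ((N - 1 : ℕ) : ℝ) + 1 = N := by rw [Nat.cast_sub hN]; simp
  rw [hNa, Real.sin_nat_mul_two_pi_sub, Real.sin_pi] at e1
  have h2N : 2 * (N : ℝ) * a = (k : ℝ) * (2 * Real.pi) - (Real.pi + a) := by linarith
  rw [hN1, h2N, Real.sin_nat_mul_two_pi_sub, Real.sin_add, Real.sin_pi, Real.cos_pi] at e2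
  have hQ : ∑ m ∈ Finset.Icc 1 N, Real.sin (a * (m : ℝ)) ^ 2 = (2 * (N : ℝ) + 1) / 4 := by
    apply mul_left_cancel₀ (mul_pos (by norm_num : (0:ℝ) < 4) hsin).ne'
    rw [e1]; ring
  have hC : ∑ n ∈ Finset.Icc 1 (N - 1), Real.sin (a * (n : ℝ)) * Real.sin (a * ((n : ℝ) + 1))
      = (2 * N * Real.cos a - 1) / 4 := by
    apply mul_left_cancel₀ (mul_pos (by norm_num : (0:ℝ) < 4) hsin).ne'
    rw [e2]; ring
  rw [hQ]
  simp only [div_mul_div_comm, Real.mul_self_sqrt (by positivity : (0:ℝ) ≤ (2 * (N : ℝ) + 1) / 4)]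
  rw [← Finset.sum_div, hC]
  field_simp

/-- Asymptotic consecutive-error correlation under optimal waterfilling coding of
the samples: with `λ_k^{(N)} = 1/(4 sin²((2k−1)π/(2(2N+1))))` and `u_{k,n}` the
normalized eigenvectors of `(min(n,m))_{n,m=1}^N`, for every `θ > 0` the averages
`(1/N)·Σ_{n=1}^{N−1} Σ_{k=1}^{N} u_{k,n} u_{k,n+1} min{λ_k^{(N)}, θ}` converge to
`∫₀¹ min{S(φ),θ} cos(πφ) dφ = ∫₀¹ min{S(φ),θ} dφ − (1/2)∫₀¹ min{S(φ),θ}/S(φ) dφ`. -/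
theorem stmt13 (θ : ℝ) (hθ : 0 < θ) :
    Tendsto (fun N : ℕ =>
        (1 / (N : ℝ)) * ∑ n ∈ Finset.Icc 1 (N - 1), ∑ k ∈ Finset.Icc 1 N,
          (Real.sin ((2 * (k : ℝ) - 1) * Real.pi * (n : ℝ) / (2 * (N : ℝ) + 1)) /
              Real.sqrt (∑ m ∈ Finset.Icc 1 N,
                Real.sin ((2 * (k : ℝ) - 1) * Real.pi * (m : ℝ) / (2 * (N : ℝ) + 1)) ^ 2)) *
          (Real.sin ((2 * (k : ℝ) - 1) * Real.pi * ((n : ℝ) + 1) / (2 * (N : ℝ) + 1)) /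
              Real.sqrt (∑ m ∈ Finset.Icc 1 N,
                Real.sin ((2 * (k : ℝ) - 1) * Real.pi * (m : ℝ) / (2 * (N : ℝ) + 1)) ^ 2)) *
          min (1 / (4 * Real.sin ((2 * (k : ℝ) - 1) * Real.pi / (2 * (2 * (N : ℝ) + 1))) ^ 2)) θ)
      atTop (nhds (∫ φ in (0:ℝ)..1, min (S φ) θ * Real.cos (Real.pi * φ)))
    ∧ (∫ φ in (0:ℝ)..1, min (S φ) θ * Real.cos (Real.pi * φ))
        = (∫ φ in (0:ℝ)..1, min (S φ) θ)
          - (1 / 2) * ∫ φ in (0:ℝ)..1, min (S φ) θ / S φ := by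
  have hcont := cS_cont θ hθ
  have hcos : Continuous (fun φ : ℝ => cS θ φ * Real.cos (Real.pi * φ)) := by fun_prop
  have hEq : Set.EqOn (cS θ) (fun φ => min (S φ) θ) (Set.uIoc (0:ℝ) 1) := by
    intro φ hφ
    rw [Set.uIoc_of_le zero_le_one] at hφ
    exact (cS_eq θ hθ φ hφ.1 hφ.2).symm
  have hEq2 : Set.EqOn (fun φ : ℝ => cS θ φ * Real.cos (Real.pi * φ))
      (fun φ => min (S φ) θ * Real.cos (Real.pi * φ)) (Set.uIoc (0:ℝ) 1) := by
    intro φ hφ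
    have := hEq hφ
    simp only at this ⊢
    rw [this]
  constructor
  · have hI : (∫ φ in (0:ℝ)..1, min (S φ) θ * Real.cos (Real.pi * φ))
        = ∫ φ in (0:ℝ)..1, cS θ φ * Real.cos (Real.pi * φ) :=
      (intervalIntegral.integral_congr_ae (ae_of_all _ (fun φ hφ => hEq2 hφ))).symm
    rw [hI]
    have l1 := aux_riemann _ hcos
    have l2 := aux_riemann _ hcont
    have l3 : Tendsto (fun N : ℕ => 1 / (2 * (N : ℝ))) atTop (nhds 0) := by
      simp only [one_div]
      apply tendsto_inv_atTop_zero.comp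
      exact tendsto_natCast_atTop_atTop.const_mul_atTop (by norm_num)
    have l4 := l1.sub (l3.mul l2)
    rw [zero_mul, sub_zero] at l4
    refine l4.congr' ?_
    filter_upwards [eventually_ge_atTop 1] with N hN
    rw [Finset.sum_comm, Finset.sum_congr rfl (fun k hk => aux_term θ hθ N hN k hk)]
    simp only [Finset.mul_sum]
    rw [← Finset.sum_sub_distrib]
    apply Finset.sum_congr rfl
    intro k _
    have hN0 : (N : ℝ) ≠ 0 := by positivity
    field_simp
  · have i1 : IntervalIntegrable (fun φ => min (S φ) θ) volume 0 1 :=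
      (hcont.intervalIntegrable 0 1).congr hEq
    have i2 : IntervalIntegrable (fun φ => min (S φ) θ * Real.cos (Real.pi * φ)) volume 0 1 :=
      (hcos.intervalIntegrable 0 1).congr hEq2
    have hpt : (fun φ => min (S φ) θ / S φ)
        = fun φ => 2 * (min (S φ) θ - min (S φ) θ * Real.cos (Real.pi * φ)) := by
      funext φ
      have hc : Real.cos (Real.pi * φ) = 1 - 2 * Real.sin (Real.pi * φ / 2) ^ 2 := by
        have h : Real.pi * φ = 2 * (Real.pi * φ / 2) := by ring
        rw [h, Real.cos_two_mul, Real.cos_sq']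
        ring_nf
      rw [hc]
      by_cases hs : Real.sin (Real.pi * φ / 2) = 0
      · have : S φ = 0 := by simp [S, hs]
        rw [this, min_eq_left hθ.le]; simp
      · have : S φ = 1 / (4 * Real.sin (Real.pi * φ / 2) ^ 2) := rfl
        generalize min (S φ) θ = m
        rw [this]; field_simp; ring
    rw [hpt, intervalIntegral.integral_const_mul, intervalIntegral.integral_sub i1 i2]
    ring
end

section
/- The function θ ↦ R̃(θ)·(1/6 + D̃(θ)) is nonincreasing on the set of θ > 0 where R̃(θ) > 0, and it converges to 2/(π²·ln 2) as θ → ∞. (Equivalently, for fixed bitrate R, the indirect distortion-rate function D(f_s,R) = (σ²/R)·R̃(θ)·(1/6 + D̃(θ)) of the Wiener process given its rate-f_s uniform samples is monotonically decreasing in the sampling rate f_s and converges to the distortion-rate function of the Wiener process D_W(R) = 2σ²/(π²·ln 2)·R⁻¹ as f_s → ∞.) -/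
open Real Filter MeasureTheory

lemma quad_step (P : ℝ → ℝ) (a b C : ℝ) (hab : a ≤ b)
    (h : ∀ x y, a ≤ x → x ≤ y → y ≤ b → P y - P x ≤ C * (y - x) ^ 2) : P b ≤ P a := by
  have key : ∀ n : ℕ, ∀ x y, a ≤ x → x ≤ y → y ≤ b →
      P y - P x ≤ C * (y - x) ^ 2 * (1 / 2) ^ n := by
    intro n
    induction n with
    | zero => intro x y h1 h2 h3; simpa using h x y h1 h2 h3
    | succ k ih =>
      intro x y h1 h2 h3
      have e1 := ih x ((x + y) / 2) h1 (by linarith) (by linarith)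
      have e2 := ih ((x + y) / 2) y (by linarith) (by linarith) h3
      have e3 : C * (y - x) ^ 2 * (1 / 2) ^ (k + 1) =
          C * ((x + y) / 2 - x) ^ 2 * (1 / 2) ^ k + C * (y - (x + y) / 2) ^ 2 * (1 / 2) ^ k := by
        rw [pow_succ]; ring
      linarith
  have hl : Tendsto (fun n : ℕ => C * (b - a) ^ 2 * (1 / 2 : ℝ) ^ n) atTop
      (nhds (C * (b - a) ^ 2 * 0)) :=
    (tendsto_pow_atTop_nhds_zero_of_lt_one (by norm_num) (by norm_num)).const_mul _
  have := ge_of_tendsto' hl (fun n => key n a b le_rfl hab le_rfl)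
  linarith

noncomputable def ff (φ : ℝ) : ℝ := S φ - 1 / 6
noncomputable def LL (θ φ : ℝ) : ℝ := max 0 (Real.log (ff φ / θ))
noncomputable def rr (θ : ℝ) : ℝ := ∫ φ in (0:ℝ)..1, LL θ φ
noncomputable def FF (θ : ℝ) : ℝ := 1 / 6 + Dtilde θ

lemma sin_pos' {φ : ℝ} (h0 : 0 < φ) (h1 : φ ≤ 1) : 0 < Real.sin (Real.pi * φ / 2) := by
  have := Real.pi_pos
  apply Real.sin_pos_of_pos_of_lt_pi
  · positivity
  · nlinarith

lemma ff_anti {x y : ℝ} (h0 : 0 < x) (hxy : x ≤ y) (h1 : y ≤ 1) : ff y ≤ ff x := by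
  unfold ff S
  have hp := Real.pi_pos
  have hx := sin_pos' h0 (hxy.trans h1)
  have : Real.sin (Real.pi * x / 2) ≤ Real.sin (Real.pi * y / 2) := by
    apply Real.sin_le_sin_of_le_of_le_pi_div_two
    · have : 0 ≤ Real.pi * x / 2 := by positivity
      linarith
    · nlinarith
    · nlinarith
  have : 1 / (4 * Real.sin (Real.pi * y / 2) ^ 2) ≤ 1 / (4 * Real.sin (Real.pi * x / 2) ^ 2) := by
    apply one_div_le_one_div_of_le
    · positivity
    · gcongr
  linarith

lemma ff_one : ff 1 = 1 / 12 := by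
  unfold ff S
  rw [mul_one, Real.sin_pi_div_two]; norm_num

lemma ff_ge {x : ℝ} (h0 : 0 < x) (h1 : x ≤ 1) : 1 / 12 ≤ ff x := by
  rw [← ff_one]; exact ff_anti h0 h1 le_rfl

lemma ff_le {x : ℝ} (h0 : 0 < x) (h1 : x ≤ 1) : ff x ≤ 1 / x ^ 2 := by
  have hp := Real.pi_pos
  have hs : x ≤ Real.sin (Real.pi * x / 2) := by
    have := Real.mul_le_sin (x := Real.pi * x / 2) (by positivity) (by nlinarith)
    have e : 2 / Real.pi * (Real.pi * x / 2) = x := by field_simp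
    linarith
  unfold ff S
  have : 1 / (4 * Real.sin (Real.pi * x / 2) ^ 2) ≤ 1 / x ^ 2 := by
    apply one_div_le_one_div_of_le
    · positivity
    · nlinarith
  linarith

lemma ff_meas : Measurable ff := by
  unfold ff S; fun_prop

lemma LL_meas (θ : ℝ) : Measurable (LL θ) := by
  unfold LL
  have := ff_meas
  fun_prop

lemma min_int (θ : ℝ) (hθ : 0 < θ) :
    IntervalIntegrable (fun φ => min θ (ff φ)) volume 0 1 := by
  have hc : IntervalIntegrable (fun _ : ℝ => θ) volume 0 1 := intervalIntegrable_const
  refine hc.mono_fun ?_ ?_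
  · have := ff_meas
    exact Measurable.aestronglyMeasurable (by fun_prop)
  · rw [Filter.EventuallyLE, ae_restrict_iff' measurableSet_uIoc]
    refine Filter.Eventually.of_forall fun x hx => ?_
    rw [Set.uIoc_of_le zero_le_one] at hx
    have := ff_ge hx.1 hx.2
    rw [Real.norm_of_nonneg (le_min hθ.le (by linarith)), Real.norm_of_nonneg hθ.le]
    exact min_le_left _ _

lemma LL_le {θ x : ℝ} (hθ : 0 < θ) (h0 : 0 < x) (h1 : x ≤ 1) :
    LL θ x ≤ 4 * θ ^ (-(1 / 4) : ℝ) * x ^ (-(1 / 2) : ℝ) := by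
  unfold LL
  apply max_le
  · positivity
  · have hf := ff_ge h0 h1
    have hp : 0 ≤ ff x / θ := div_nonneg (by linarith) hθ.le
    have e1 := Real.log_le_rpow_div hp (show (0:ℝ) < 1 / 4 by norm_num)
    have e2 : (ff x / θ) ^ (1 / 4 : ℝ) ≤ (1 / x ^ 2 / θ) ^ (1 / 4 : ℝ) := by
      apply Real.rpow_le_rpow hp _ (by norm_num)
      gcongr
      exact ff_le h0 h1
    have e3 : (1 / x ^ 2 / θ) ^ (1 / 4 : ℝ) = θ ^ (-(1 / 4) : ℝ) * x ^ (-(1 / 2) : ℝ) := by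
      rw [Real.div_rpow (by positivity) hθ.le, Real.rpow_neg hθ.le, one_div (x ^ 2),
        Real.inv_rpow (by positivity), ← Real.rpow_natCast, ← Real.rpow_mul h0.le,
        Real.rpow_neg h0.le]
      norm_num
      rw [div_eq_mul_inv, mul_comm]
    rw [e3] at e2
    calc _ ≤ _ := e1
      _ = 4 * (ff x / θ) ^ (1 / 4 : ℝ) := by ring
      _ ≤ _ := by rw [mul_assoc]; gcongr

lemma LL_nonneg (θ x : ℝ) : 0 ≤ LL θ x := le_max_left _ _

lemma rpow_int (C : ℝ) : IntervalIntegrable (fun x : ℝ => C * x ^ (-(1 / 2) : ℝ)) volume 0 1 :=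
  (intervalIntegral.intervalIntegrable_rpow' (by norm_num)).const_mul _

lemma LL_int (θ : ℝ) (hθ : 0 < θ) : IntervalIntegrable (LL θ) volume 0 1 := by
  refine (rpow_int (4 * θ ^ (-(1 / 4) : ℝ))).mono_fun (LL_meas θ).aestronglyMeasurable ?_
  rw [Filter.EventuallyLE, ae_restrict_iff' measurableSet_uIoc]
  refine Filter.Eventually.of_forall fun x hx => ?_
  rw [Set.uIoc_of_le zero_le_one] at hx
  rw [Real.norm_of_nonneg (LL_nonneg _ _)]
  exact (LL_le hθ hx.1 hx.2).trans (le_abs_self _)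

lemma rr_nonneg (θ : ℝ) : 0 ≤ rr θ :=
  intervalIntegral.integral_nonneg zero_le_one fun x _ => LL_nonneg θ x

lemma rr_le (θ : ℝ) (hθ : 0 < θ) : rr θ ≤ 8 * θ ^ (-(1 / 4) : ℝ) := by
  have h : rr θ ≤ ∫ x in (0:ℝ)..1, 4 * θ ^ (-(1 / 4) : ℝ) * x ^ (-(1 / 2) : ℝ) := by
    apply intervalIntegral.integral_mono_on_of_le_Ioo zero_le_one (LL_int θ hθ) (rpow_int _)
    intro x hx
    exact LL_le hθ hx.1 hx.2.le
  rw [intervalIntegral.integral_const_mul, integral_rpow (by left; norm_num)] at h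
  norm_num at h
  norm_num
  linarith

lemma rr_tendsto : Tendsto rr atTop (nhds 0) := by
  have h1 : Tendsto (fun θ : ℝ => 8 * θ ^ (-(1 / 4) : ℝ)) atTop (nhds (8 * 0)) :=
    (tendsto_rpow_neg_atTop (by norm_num)).const_mul _
  rw [mul_zero] at h1
  refine squeeze_zero' (Filter.Eventually.of_forall rr_nonneg) ?_ h1
  filter_upwards [eventually_gt_atTop 0] with θ hθ using rr_le θ hθ

lemma LL_eq {θ x : ℝ} (hθ : 0 < θ) (h0 : 0 < ff x) :
    LL θ x = Real.log (ff x) - Real.log (min θ (ff x)) := by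
  unfold LL
  rw [Real.log_div h0.ne' hθ.ne']
  rcases le_total θ (ff x) with h | h
  · rw [min_eq_left h, max_eq_right]
    have := Real.log_le_log hθ h; linarith
  · rw [min_eq_right h, max_eq_left]
    · ring
    have := Real.log_le_log h0 h; linarith

lemma LL_diff_lower {t u x : ℝ} (ht : 0 < t) (htu : t ≤ u) (h0 : 0 < ff x) :
    (min u (ff x) - min t (ff x)) / u ≤ LL t x - LL u x := by
  have hu := ht.trans_le htu
  rw [LL_eq ht h0, LL_eq hu h0]
  have p1 : 0 < min t (ff x) := lt_min ht h0
  have p2 : 0 < min u (ff x) := lt_min hu h0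
  have p3 : min t (ff x) ≤ min u (ff x) := min_le_min_right _ htu
  have p4 : min u (ff x) ≤ u := min_le_left _ _
  generalize min t (ff x) = y at *
  generalize min u (ff x) = z at *
  have := Real.one_sub_inv_le_log_of_pos (show 0 < z / y by positivity)
  rw [Real.log_div p2.ne' p1.ne'] at this
  have e : 1 - (z / y)⁻¹ = (z - y) / z := by field_simp
  have : (z - y) / u ≤ (z - y) / z := by
    apply div_le_div_of_nonneg_left (by linarith) p2 p4
  linarith

lemma LL_diff_upper {t u x : ℝ} (ht : 0 < t) (htu : t ≤ u) (h0 : 0 < ff x) :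
    LL t x - LL u x ≤ (min u (ff x) - min t (ff x)) / t := by
  have hu := ht.trans_le htu
  rw [LL_eq ht h0, LL_eq hu h0]
  rcases le_total t (ff x) with h | h
  · rw [min_eq_left h]
    have p2 : 0 < min u (ff x) := lt_min hu h0
    generalize min u (ff x) = z at *
    have := Real.log_le_sub_one_of_pos (show 0 < z / t by positivity)
    rw [Real.log_div p2.ne' ht.ne'] at this
    have e : z / t - 1 = (z - t) / t := by field_simp
    linarith
  · rw [min_eq_right h, min_eq_right (h.trans htu)]; simp

lemma Dtilde_eq (θ : ℝ) : Dtilde θ = ∫ φ in (0:ℝ)..1, min θ (ff φ) := rfl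

lemma rr_diff_lower {t u : ℝ} (ht : 0 < t) (htu : t ≤ u) :
    (FF u - FF t) / u ≤ rr t - rr u := by
  have hu := ht.trans_le htu
  have : ∫ x in (0:ℝ)..1, (min u (ff x) - min t (ff x)) / u ≤ ∫ x in (0:ℝ)..1, (LL t x - LL u x) := by
    apply intervalIntegral.integral_mono_on_of_le_Ioo zero_le_one
      (((min_int u hu).sub (min_int t ht)).div_const u) ((LL_int t ht).sub (LL_int u hu))
    intro x hx
    exact LL_diff_lower ht htu (by have := ff_ge hx.1 hx.2.le; linarith)
  rw [intervalIntegral.integral_div, intervalIntegral.integral_sub (min_int u hu) (min_int t ht),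
    intervalIntegral.integral_sub (LL_int t ht) (LL_int u hu), ← Dtilde_eq, ← Dtilde_eq] at this
  unfold FF rr
  rwa [add_sub_add_left_eq_sub]

lemma rr_diff_upper {t u : ℝ} (ht : 0 < t) (htu : t ≤ u) :
    rr t - rr u ≤ (FF u - FF t) / t := by
  have hu := ht.trans_le htu
  have : ∫ x in (0:ℝ)..1, (LL t x - LL u x) ≤ ∫ x in (0:ℝ)..1, (min u (ff x) - min t (ff x)) / t := by
    apply intervalIntegral.integral_mono_on_of_le_Ioo zero_le_one
       ((LL_int t ht).sub (LL_int u hu)) (((min_int u hu).sub (min_int t ht)).div_const t)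
    intro x hx
    exact LL_diff_upper ht htu (by have := ff_ge hx.1 hx.2.le; linarith)
  rw [intervalIntegral.integral_div, intervalIntegral.integral_sub (min_int u hu) (min_int t ht),
    intervalIntegral.integral_sub (LL_int t ht) (LL_int u hu), ← Dtilde_eq, ← Dtilde_eq] at this
  unfold FF rr
  rwa [add_sub_add_left_eq_sub]

lemma FF_mono {t u : ℝ} (ht : 0 < t) (htu : t ≤ u) : FF t ≤ FF u := by
  have hu := ht.trans_le htu
  unfold FF
  rw [Dtilde_eq, Dtilde_eq]
  gcongr
  apply intervalIntegral.integral_mono_on_of_le_Ioo zero_le_one (min_int t ht) (min_int u hu)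
  intro x hx
  exact min_le_min_right _ htu

lemma ff_int {a : ℝ} (h0 : 0 < a) (h1 : a ≤ 1) : IntervalIntegrable ff volume a 1 := by
  apply ContinuousOn.intervalIntegrable
  rw [Set.uIcc_of_le h1]
  unfold ff S
  have : ∀ x ∈ Set.Icc a 1, 4 * Real.sin (Real.pi * x / 2) ^ 2 ≠ 0 := by
    intro x hx
    have := sin_pos' (h0.trans_le hx.1) hx.2
    positivity
  fun_prop (disch := assumption)

lemma ff_integral {a : ℝ} (h0 : 0 < a) (h1 : a ≤ 1) :
    ∫ x in a..1, ff x = Real.cos (Real.pi * a / 2) / Real.sin (Real.pi * a / 2) / (2 * Real.pi)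
      - (1 - a) / 6 := by
  have hp := Real.pi_pos
  have hd : ∀ x ∈ Set.uIcc a 1, HasDerivAt (fun x => -(Real.cos (Real.pi * x / 2) /
      Real.sin (Real.pi * x / 2) / (2 * Real.pi)) - x / 6) (ff x) x := by
    intro x hx
    rw [Set.uIcc_of_le h1] at hx
    have hs := sin_pos' (h0.trans_le hx.1) hx.2
    have hl : HasDerivAt (fun x : ℝ => Real.pi * x / 2) (Real.pi / 2) x := by
      simpa using ((hasDerivAt_id x).const_mul Real.pi).div_const 2
    have := (((hl.cos.div hl.sin hs.ne').div_const (2 * Real.pi)).neg).sub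
      ((hasDerivAt_id x).div_const 6)
    refine this.congr_deriv ?_
    unfold ff S
    have := Real.sin_sq_add_cos_sq (Real.pi * x / 2)
    field_simp
    linear_combination 24 * this
  rw [intervalIntegral.integral_eq_sub_of_hasDerivAt hd (ff_int h0 h1), mul_one,
    Real.cos_pi_div_two]
  ring

lemma D_split {a θ : ℝ} (h0 : 0 < a) (h1 : a ≤ 1) (hθ : θ = ff a) :
    Dtilde θ = θ * a + ∫ x in a..1, ff x := by
  have hpos : 0 < θ := by have := ff_ge h0 h1; linarith
  have hi := min_int θ hpos
  have i1 : IntervalIntegrable (fun φ => min θ (ff φ)) volume 0 a :=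
    hi.mono_set (by rw [Set.uIcc_of_le h0.le, Set.uIcc_of_le zero_le_one]; exact Set.Icc_subset_Icc_right h1)
  have i2 : IntervalIntegrable (fun φ => min θ (ff φ)) volume a 1 :=
    hi.mono_set (by rw [Set.uIcc_of_le h1, Set.uIcc_of_le zero_le_one]; exact Set.Icc_subset_Icc_left h0.le)
  rw [Dtilde_eq, ← intervalIntegral.integral_add_adjacent_intervals i1 i2]
  congr 1
  · have : ∫ φ in (0:ℝ)..a, min θ (ff φ) = ∫ φ in (0:ℝ)..a, θ := by
      apply intervalIntegral.integral_congr_ae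
      refine Filter.Eventually.of_forall fun x hx => ?_
      rw [Set.uIoc_of_le h0.le] at hx
      rw [min_eq_left]
      rw [hθ]; exact ff_anti hx.1 hx.2 h1
    rw [this]; simp [mul_comm]
  · apply intervalIntegral.integral_congr
    intro x hx
    rw [Set.uIcc_of_le h1] at hx
    simp only
    rw [min_eq_right]
    rw [hθ]; exact ff_anti h0 hx.1 hx.2

lemma D_split_le {a θ : ℝ} (h0 : 0 < a) (h1 : a ≤ 1) (hpos : 0 < θ) :
    Dtilde θ ≤ θ * a + ∫ x in a..1, ff x := by
  have hi := min_int θ hpos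
  have i1 : IntervalIntegrable (fun φ => min θ (ff φ)) volume 0 a :=
    hi.mono_set (by rw [Set.uIcc_of_le h0.le, Set.uIcc_of_le zero_le_one]; exact Set.Icc_subset_Icc_right h1)
  have i2 : IntervalIntegrable (fun φ => min θ (ff φ)) volume a 1 :=
    hi.mono_set (by rw [Set.uIcc_of_le h1, Set.uIcc_of_le zero_le_one]; exact Set.Icc_subset_Icc_left h0.le)
  rw [Dtilde_eq, ← intervalIntegral.integral_add_adjacent_intervals i1 i2]
  apply add_le_add
  · have : ∫ φ in (0:ℝ)..a, min θ (ff φ) ≤ ∫ φ in (0:ℝ)..a, θ := by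
      apply intervalIntegral.integral_mono_on h0.le i1 intervalIntegrable_const
      intro x _; exact min_le_left _ _
    refine this.trans ?_
    simp [mul_comm]
  · apply intervalIntegral.integral_mono_on h1 i2 (ff_int h0 h1)
    intro x _; exact min_le_right _ _

noncomputable def AA (θ : ℝ) : ℝ := Real.arcsin (1 / (2 * √(θ + 1 / 6)))

lemma AA_arg {θ : ℝ} (h : 1 / 12 ≤ θ) : 1 / (2 * √(θ + 1 / 6)) ≤ 1 := by
  have : (1 / 2 : ℝ) ≤ √(θ + 1 / 6) := by
    apply Real.le_sqrt_of_sq_le; linarith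
  rw [div_le_one (by linarith)]; linarith

lemma AA_pos {θ : ℝ} (h : 1 / 12 ≤ θ) : 0 < AA θ := by
  have : 0 < √(θ + 1 / 6) := Real.sqrt_pos.2 (by linarith)
  exact Real.arcsin_pos.2 (by positivity)

lemma AA_le (θ : ℝ) : AA θ ≤ Real.pi / 2 := Real.arcsin_le_pi_div_two _

lemma sin_AA {θ : ℝ} (h : 1 / 12 ≤ θ) : Real.sin (AA θ) = 1 / (2 * √(θ + 1 / 6)) := by
  apply Real.sin_arcsin _ (AA_arg h)
  have : 0 ≤ 1 / (2 * √(θ + 1 / 6)) := by positivity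
  linarith

lemma theta_eq {θ : ℝ} (h : 1 / 12 ≤ θ) : θ + 1 / 6 = 1 / (4 * Real.sin (AA θ) ^ 2) := by
  rw [sin_AA h, div_pow, mul_pow, Real.sq_sqrt (by linarith)]
  have : θ + 1 / 6 ≠ 0 := by linarith
  field_simp
  norm_num

lemma ff_AA {θ : ℝ} (h : 1 / 12 ≤ θ) : θ = ff (2 / Real.pi * AA θ) := by
  have e : Real.pi * (2 / Real.pi * AA θ) / 2 = AA θ := by
    have := Real.pi_pos; field_simp
  unfold ff S
  rw [e, ← theta_eq h]; ring

lemma aa_pos {θ : ℝ} (h : 1 / 12 ≤ θ) : 0 < 2 / Real.pi * AA θ := by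
  have := AA_pos h; have := Real.pi_pos; positivity

lemma aa_le (θ : ℝ) : 2 / Real.pi * AA θ ≤ 1 := by
  have h := AA_le θ
  have hp := Real.pi_pos
  rw [div_mul_eq_mul_div, div_le_one hp]; linarith

lemma FF_formula {θ : ℝ} (h : 1 / 12 ≤ θ) :
    FF θ = (θ + 1 / 6) * (2 / Real.pi * AA θ)
      + Real.cos (AA θ) / Real.sin (AA θ) / (2 * Real.pi) := by
  have e : Real.pi * (2 / Real.pi * AA θ) / 2 = AA θ := by
    have := Real.pi_pos; field_simp
  unfold FF
  rw [D_split (aa_pos h) (aa_le θ) (ff_AA h), ff_integral (aa_pos h) (aa_le θ), e]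
  ring

lemma exists_a {θ : ℝ} (hθ : 0 < θ) : ∃ a : ℝ, 0 < a ∧ a ≤ 1 ∧ 2 * a * θ ≤ FF θ ∧
    ∀ u, θ ≤ u → FF u - FF θ ≤ a * (u - θ) := by
  rcases le_total (1 / 12) θ with h | h
  · refine ⟨2 / Real.pi * AA θ, aa_pos h, aa_le θ, ?_, ?_⟩
    · rw [FF_formula h]
      have hA := AA_pos h
      have hA2 := AA_le θ
      have ht := theta_eq h
      have hs : 0 < Real.sin (AA θ) := by
        apply Real.sin_pos_of_pos_of_lt_pi hA; linarith [Real.pi_pos]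
      have hp := Real.pi_pos
      have hc : 0 ≤ Real.cos (AA θ) := Real.cos_nonneg_of_mem_Icc ⟨by linarith, hA2⟩
      have hsc : AA θ * Real.cos (AA θ) ≤ Real.sin (AA θ) := by
        rcases hc.eq_or_lt with hc | hc
        · rw [← hc]; simpa using hs.le
        · have := Real.le_tan hA.le (lt_of_le_of_ne hA2 (by
            intro h'; rw [h', Real.cos_pi_div_two] at hc; exact hc.false))
          rw [Real.tan_eq_sin_div_cos, le_div_iff₀ hc] at this
          exact this
      have hsq := Real.sin_sq_add_cos_sq (AA θ)
      have ht2 : θ = 1 / (4 * Real.sin (AA θ) ^ 2) - 1 / 6 := by linarith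
      generalize AA θ = A at *
      have key : A * (1 - 4 / 3 * Real.sin A ^ 2) ≤ Real.sin A * Real.cos A := by
        nlinarith [mul_le_mul_of_nonneg_right hsc hc, mul_pos hA (pow_pos hs 2)]
      rw [← sub_nonneg]
      have : (θ + 1 / 6) * (2 / Real.pi * A) + Real.cos A / Real.sin A / (2 * Real.pi)
          - 2 * (2 / Real.pi * A) * θ =
          (Real.sin A * Real.cos A - A * (1 - 4 / 3 * Real.sin A ^ 2)) /
            (2 * Real.pi * Real.sin A ^ 2) := by
        rw [ht2]; field_simp; ring
      rw [this]
      apply div_nonneg (by linarith) (by positivity)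
    · intro u hu
      have e1 := D_split (aa_pos h) (aa_le θ) (ff_AA h)
      have e2 := D_split_le (aa_pos h) (aa_le θ) (hθ.trans_le hu)
      unfold FF
      linarith
  · refine ⟨1, one_pos, le_rfl, ?_, ?_⟩
    · have : Dtilde θ = ∫ φ in (0:ℝ)..1, θ := by
        rw [Dtilde_eq]
        apply intervalIntegral.integral_congr_ae
        refine Filter.Eventually.of_forall fun x hx => ?_
        rw [Set.uIoc_of_le zero_le_one] at hx
        rw [min_eq_left]
        exact h.trans (ff_ge hx.1 hx.2)
      unfold FF
      rw [this]; simp; linarith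
    · intro u hu
      have : Dtilde θ = ∫ φ in (0:ℝ)..1, θ := by
        rw [Dtilde_eq]
        apply intervalIntegral.integral_congr_ae
        refine Filter.Eventually.of_forall fun x hx => ?_
        rw [Set.uIoc_of_le zero_le_one] at hx
        rw [min_eq_left]
        exact h.trans (ff_ge hx.1 hx.2)
      have e2 := D_split_le one_pos le_rfl (hθ.trans_le hu)
      unfold FF
      rw [this]
      simp at e2 ⊢
      linarith

lemma HH_anti {t u : ℝ} (ht : 0 < t) (htu : t ≤ u) : FF u / u - rr u ≤ FF t / t - rr t := by
  apply quad_step (fun θ => FF θ / θ - rr θ) t u (1 / t ^ 2) htu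
  intro x y h1 h2 _
  have hx := ht.trans_le h1
  have hy := hx.trans_le h2
  obtain ⟨a, ha0, ha1, hF, hd⟩ := exists_a hx
  have hd := hd y h2
  have hr := rr_diff_upper hx h2
  have e1 : FF y / y - rr y - (FF x / x - rr x) ≤
      ((FF y - FF x) * (x + y) - FF x * (y - x)) / (x * y) := by
    have : ((FF y - FF x) * (x + y) - FF x * (y - x)) / (x * y) =
      (FF y - FF x) / x + FF y / y - FF x / x := by field_simp; ring
    rw [this]; linarith
  refine e1.trans ?_
  have e2 : (FF y - FF x) * (x + y) - FF x * (y - x) ≤ (y - x) ^ 2 := by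
    have q1 := mul_le_mul_of_nonneg_right hd (show 0 ≤ x + y by linarith)
    have q2 := mul_le_mul_of_nonneg_right hF (show 0 ≤ y - x by linarith)
    have q3 := mul_le_mul_of_nonneg_right ha1 (sq_nonneg (y - x))
    nlinarith
  rw [one_div_mul_eq_div]
  apply div_le_div₀ (sq_nonneg _) e2 (by positivity)
  rw [sq]
  exact mul_le_mul h1 (h1.trans h2) ht.le hx.le

lemma AA_tendsto : Tendsto AA atTop (nhds 0) := by
  have h1 : Tendsto (fun θ : ℝ => √(θ + 1 / 6)) atTop atTop :=
    Real.tendsto_sqrt_atTop.comp (tendsto_atTop_add_const_right _ _ tendsto_id)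
  have h2 : Tendsto (fun θ : ℝ => 1 / (2 * √(θ + 1 / 6))) atTop (nhds 0) :=
    tendsto_const_nhds.div_atTop (h1.const_mul_atTop two_pos)
  have := (Real.continuous_arcsin.tendsto 0).comp h2
  rw [Real.arcsin_zero] at this
  exact this

lemma sinc_tendsto : Tendsto (fun θ => Real.sinc (AA θ)) atTop (nhds 1) := by
  have := (Real.continuous_sinc.tendsto 0).comp AA_tendsto
  rw [Real.sinc_zero] at this
  exact this

lemma sin_AA_pos {θ : ℝ} (h : 1 / 12 ≤ θ) : 0 < Real.sin (AA θ) := by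
  apply Real.sin_pos_of_pos_of_lt_pi (AA_pos h)
  linarith [Real.pi_pos, AA_le θ]

lemma sin_eq_sinc {θ : ℝ} (h : 1 / 12 ≤ θ) : Real.sin (AA θ) = Real.sinc (AA θ) * AA θ := by
  have := AA_pos h
  rw [Real.sinc_of_ne_zero this.ne']; field_simp

lemma sinc_pos {θ : ℝ} (h : 1 / 12 ≤ θ) : 0 < Real.sinc (AA θ) := by
  have := AA_pos h
  have := sin_AA_pos h
  rw [Real.sinc_of_ne_zero (AA_pos h).ne']; positivity

lemma FA_tendsto : Tendsto (fun θ => FF θ * AA θ) atTop (nhds (1 / Real.pi)) := by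
  have hq : Tendsto (fun θ => (Real.sinc (AA θ))⁻¹) atTop (nhds 1⁻¹) :=
    sinc_tendsto.inv₀ one_ne_zero
  have hc : Tendsto (fun θ => Real.cos (AA θ)) atTop (nhds 1) := by
    have := (Real.continuous_cos.tendsto 0).comp AA_tendsto
    rw [Real.cos_zero] at this
    exact this
  have h := (((hq.pow 2).div_const (2 * Real.pi)).add ((hq.mul hc).div_const (2 * Real.pi)))
  have e : (1⁻¹ : ℝ) ^ 2 / (2 * Real.pi) + 1⁻¹ * 1 / (2 * Real.pi) = 1 / Real.pi := by
    have := Real.pi_pos; field_simp; norm_num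
  rw [e] at h
  refine h.congr' ?_
  filter_upwards [eventually_ge_atTop (1 / 12)] with θ hθ
  have h1 := AA_pos hθ
  have h2 := sinc_pos hθ
  have hp := Real.pi_pos
  rw [FF_formula hθ, theta_eq hθ, sin_eq_sinc hθ]
  field_simp
  ring

lemma tA_tendsto : Tendsto (fun θ => θ * AA θ ^ 2) atTop (nhds (1 / 4)) := by
  have hq : Tendsto (fun θ => (Real.sinc (AA θ))⁻¹) atTop (nhds 1⁻¹) :=
    sinc_tendsto.inv₀ one_ne_zero
  have h := ((hq.pow 2).div_const 4).sub ((AA_tendsto.pow 2).div_const 6)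
  have e : (1⁻¹ : ℝ) ^ 2 / 4 - 0 ^ 2 / 6 = 1 / 4 := by norm_num
  rw [e] at h
  refine h.congr' ?_
  filter_upwards [eventually_ge_atTop (1 / 12)] with θ hθ
  have h1 := AA_pos hθ
  have h2 := sinc_pos hθ
  have h3 := theta_eq hθ
  rw [sin_eq_sinc hθ] at h3
  have h4 : θ * AA θ ^ 2 = (θ + 1 / 6) * AA θ ^ 2 - AA θ ^ 2 / 6 := by ring
  rw [h4, h3]
  field_simp

lemma Ft_tendsto : Tendsto (fun θ => FF θ / θ) atTop (nhds 0) := by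
  have h := (FA_tendsto.mul AA_tendsto).div tA_tendsto (by norm_num)
  rw [mul_zero, zero_div] at h
  refine h.congr' ?_
  filter_upwards [eventually_ge_atTop (1 / 12)] with θ hθ
  have h1 := AA_pos hθ
  have h2 : 0 < θ := by linarith
  simp only [Pi.div_apply]
  field_simp

lemma F2t_tendsto : Tendsto (fun θ => FF θ / θ * FF θ) atTop (nhds (4 / Real.pi ^ 2)) := by
  have h := (FA_tendsto.pow 2).div tA_tendsto (by norm_num)
  have e : (1 / Real.pi) ^ 2 / (1 / 4) = 4 / Real.pi ^ 2 := by
    have := Real.pi_pos; field_simp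
  rw [e] at h
  refine h.congr' ?_
  filter_upwards [eventually_ge_atTop (1 / 12)] with θ hθ
  have h1 := AA_pos hθ
  have h2 : 0 < θ := by linarith
  simp only [Pi.div_apply]
  field_simp

lemma key_ineq {θ : ℝ} (hθ : 0 < θ) : rr θ ≤ FF θ / θ := by
  have h : Tendsto (fun u => FF u / u - rr u) atTop (nhds (0 - 0)) := Ft_tendsto.sub rr_tendsto
  rw [sub_zero] at h
  have : 0 ≤ FF θ / θ - rr θ := by
    refine le_of_tendsto h ?_
    filter_upwards [eventually_ge_atTop θ] with u hu using HH_anti hθ hu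
  linarith

lemma PP_anti {t u : ℝ} (ht : 0 < t) (htu : t ≤ u) : rr u * FF u ≤ rr t * FF t := by
  apply quad_step (fun θ => rr θ * FF θ) t u (1 / t) htu
  intro x y h1 h2 _
  have hx := ht.trans_le h1
  have hy := hx.trans_le h2
  obtain ⟨a, ha0, ha1, hF, hd⟩ := exists_a hx
  have hd := hd y h2
  have hFx : 0 ≤ FF x := le_trans (by positivity) hF
  have hr := rr_diff_lower hx h2
  have hm := FF_mono hx h2
  have hk := key_ineq hy
  have hδ : FF y - FF x ≤ y - x := hd.trans (by nlinarith)
  have q1 := mul_le_mul_of_nonneg_right hr hFx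
  have q2 := mul_le_mul_of_nonneg_right hk (show 0 ≤ FF y - FF x by linarith)
  have q3 : rr y * FF y - rr x * FF x ≤ (FF y - FF x) ^ 2 / y := by
    have : (FF y - FF x) ^ 2 / y = FF y / y * (FF y - FF x) - (FF y - FF x) / y * FF x := by ring
    rw [this]; nlinarith
  refine q3.trans ?_
  rw [one_div_mul_eq_div]
  apply div_le_div₀ (sq_nonneg _) _ ht (h1.trans h2)
  exact pow_le_pow_left₀ (by linarith) hδ 2

lemma rr_lower {θ : ℝ} (h : 1 / 12 ≤ θ) :
    4 / Real.pi * AA θ * (1 + Real.log (Real.sinc (AA θ))) ≤ rr θ := by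
  have hθ : 0 < θ := by linarith
  have ha0 := aa_pos h
  have ha1 := aa_le θ
  have hA := AA_pos h
  have hs := sinc_pos h
  have hf := ff_AA h
  have hp := Real.pi_pos
  set a := 2 / Real.pi * AA θ with hadef
  have hAa : AA θ = Real.pi * a / 2 := by rw [hadef]; field_simp
  have i1 : IntervalIntegrable (LL θ) volume 0 a :=
    (LL_int θ hθ).mono_set (by
      rw [Set.uIcc_of_le ha0.le, Set.uIcc_of_le zero_le_one]; exact Set.Icc_subset_Icc_right ha1)
  have i2 : IntervalIntegrable (LL θ) volume a 1 :=
    (LL_int θ hθ).mono_set (by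
      rw [Set.uIcc_of_le ha1, Set.uIcc_of_le zero_le_one]; exact Set.Icc_subset_Icc_left ha0.le)
  have e1 : ∫ x in (0:ℝ)..a, LL θ x ≤ rr θ := by
    unfold rr
    rw [← intervalIntegral.integral_add_adjacent_intervals i1 i2]
    have := intervalIntegral.integral_nonneg (μ := volume) ha1 fun x _ => LL_nonneg θ x
    linarith
  refine le_trans ?_ e1
  have il : IntervalIntegrable Real.log volume 0 a := intervalIntegral.intervalIntegrable_log'
  set c := 2 * (Real.log (Real.sinc (AA θ)) + Real.log a) with hc
  have ic : IntervalIntegrable (fun _ : ℝ => c) volume 0 a := intervalIntegrable_const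
  have e2 : ∫ x in (0:ℝ)..a, (c - 2 * Real.log x) ≤ ∫ x in (0:ℝ)..a, LL θ x := by
    apply intervalIntegral.integral_mono_on_of_le_Ioo ha0.le (ic.sub (il.const_mul 2)) i1
    intro x hx
    have hx1 : x ≤ 1 := hx.2.le.trans ha1
    have hsx := sin_pos' hx.1 hx1
    have hsl : Real.sin (Real.pi * x / 2) ≤ Real.pi * x / 2 :=
      Real.sin_le (by have := hx.1; positivity)
    have hfx : θ ≤ ff x := by rw [hf]; exact ff_anti hx.1 hx.2.le ha1
    have hx0 := hx.1
    have g1 : (Real.sinc (AA θ) * a / x) ^ 2 ≤ ff x / θ := by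
      have g2 : (θ + 1 / 6) * (Real.sinc (AA θ) * a / x) ^ 2 ≤ ff x + 1 / 6 := by
        rw [theta_eq h, sin_eq_sinc h, hAa]
        have : 1 / (4 * (Real.sinc (Real.pi * a / 2) * (Real.pi * a / 2)) ^ 2) *
            (Real.sinc (Real.pi * a / 2) * a / x) ^ 2 = 1 / (4 * (Real.pi * x / 2) ^ 2) := by
          rw [hAa] at hs
          field_simp
        rw [this]
        have : ff x + 1 / 6 = 1 / (4 * Real.sin (Real.pi * x / 2) ^ 2) := by
          unfold ff S; ring
        rw [this]
        apply one_div_le_one_div_of_le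
        · positivity
        · gcongr
      rw [le_div_iff₀ hθ]
      generalize (Real.sinc (AA θ) * a / x) ^ 2 = w at *
      rcases le_total 1 w with hw | hw
      · nlinarith
      · nlinarith
    have g3 : c - 2 * Real.log x = Real.log ((Real.sinc (AA θ) * a / x) ^ 2) := by
      rw [Real.log_pow, Real.log_div (by positivity) hx0.ne', Real.log_mul hs.ne' ha0.ne', hc]
      push_cast; ring
    rw [g3]
    exact (Real.log_le_log (by positivity) g1).trans (le_max_right _ _)
  refine le_trans (le_of_eq ?_) e2
  rw [intervalIntegral.integral_sub ic (il.const_mul 2),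
    intervalIntegral.integral_const_mul (2:ℝ) Real.log, integral_log]
  simp only [intervalIntegral.integral_const, smul_eq_mul, hc]
  have : 4 / Real.pi * AA θ = 2 * a := by rw [hadef]; ring
  rw [this]
  ring_nf

lemma PP_tendsto : Tendsto (fun θ => rr θ * FF θ) atTop (nhds (4 / Real.pi ^ 2)) := by
  have hl : Tendsto (fun θ => 4 / Real.pi * (FF θ * AA θ) * (1 + Real.log (Real.sinc (AA θ))))
      atTop (nhds (4 / Real.pi * (1 / Real.pi) * (1 + Real.log 1))) :=
    (FA_tendsto.const_mul _).mul ((sinc_tendsto.log one_ne_zero).const_add 1)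
  have e : 4 / Real.pi * (1 / Real.pi) * (1 + Real.log 1) = 4 / Real.pi ^ 2 := by
    rw [Real.log_one]; have := Real.pi_pos; field_simp; norm_num
  rw [e] at hl
  refine tendsto_of_tendsto_of_tendsto_of_le_of_le' hl F2t_tendsto ?_ ?_
  · filter_upwards [eventually_ge_atTop (1 / 12)] with θ hθ
    have h0 : 0 < θ := by linarith
    obtain ⟨a, ha0, ha1, hF, hd⟩ := exists_a h0
    have hFx : 0 ≤ FF θ := le_trans (by positivity) hF
    have := mul_le_mul_of_nonneg_right (rr_lower hθ) hFx
    calc _ = _ := by ring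
      _ ≤ _ := this
  · filter_upwards [eventually_ge_atTop (1 / 12)] with θ hθ
    have h0 : 0 < θ := by linarith
    obtain ⟨a, ha0, ha1, hF, hd⟩ := exists_a h0
    have hFx : 0 ≤ FF θ := le_trans (by positivity) hF
    exact mul_le_mul_of_nonneg_right (key_ineq h0) hFx

lemma Rtilde_eq (θ : ℝ) : Rtilde θ = 1 / (2 * Real.log 2) * rr θ := by
  unfold Rtilde rr
  have hl : 0 < Real.log 2 := Real.log_pos one_lt_two
  have : (fun φ => max 0 (Real.logb 2 ((S φ - 1 / 6) / θ))) = fun φ => LL θ φ / Real.log 2 := by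
    funext φ
    unfold LL ff Real.logb
    rw [← max_div_div_right hl.le, zero_div]
  rw [this, intervalIntegral.integral_div]
  field_simp

lemma RD_prod_eq (θ : ℝ) : Rtilde θ * (1 / 6 + Dtilde θ) = 1 / (2 * Real.log 2) * (rr θ * FF θ) := by
  rw [Rtilde_eq]; unfold FF; ring

/-- `θ ↦ R̃(θ)(1/6 + D̃(θ))` is nonincreasing where `R̃(θ) > 0`, and tends to
`2/(π² ln 2)` as `θ → ∞`; equivalently, for fixed bitrate `R` the indirect
distortion-rate function `D(f_s,R) = (σ²/R)·R̃(θ)(1/6 + D̃(θ))` is monotonically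
decreasing in `f_s` and converges to `D_W(R) = 2σ²/(π² ln 2)·R⁻¹` as `f_s → ∞`. -/
theorem stmt18 :
    AntitoneOn (fun θ : ℝ => Rtilde θ * (1 / 6 + Dtilde θ))
        {θ : ℝ | 0 < θ ∧ 0 < Rtilde θ}
    ∧ Tendsto (fun θ : ℝ => Rtilde θ * (1 / 6 + Dtilde θ)) atTop
        (nhds (2 / (Real.pi ^ 2 * Real.log 2))) := by
  have hl : 0 < Real.log 2 := Real.log_pos one_lt_two
  simp only [RD_prod_eq]
  constructor
  · intro t ht u _ htu
    exact mul_le_mul_of_nonneg_left (PP_anti ht.1 htu) (by positivity)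
  · have h := PP_tendsto.const_mul (1 / (2 * Real.log 2))
    have e : 1 / (2 * Real.log 2) * (4 / Real.pi ^ 2) = 2 / (Real.pi ^ 2 * Real.log 2) := by
      have := Real.pi_pos; field_simp; norm_num
    rwa [e] at h
end
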